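/- arXiv:2208.09935 — 5 statements merged into one kernel-verified Lean document; each statement's English description precedes it below -/
import Mathlib

section
/- Let D be an integral domain that is not a field and let K be its field of fractions. If a rational function φ ∈ K(x) satisfies φ(r) ∈ D (in particular, φ is defined at r) for all but finitely many r ∈ K, then φ is defined at every element of K and φ(r) ∈ D for every r ∈ K; that is, φ ∈ IntR(K, D). -/
open Polynomial

/-- Local expansion of `p` at `r` with `D`-integral error term. -/
def LocExp {K : Type*} [Field K] (D : Subring K) (r : K) (p : K[X]) : Prop :=
  ∃ c ∈ D, c ≠ 0 ∧ ∀ s ∈ D, ∃ e ∈ D, p.eval (r + c * s) = p.eval r + s * e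

lemma locExp_add {K : Type*} [Field K] {D : Subring K} {r : K} {p q : K[X]}
    (hp : LocExp D r p) (hq : LocExp D r q) : LocExp D r (p + q) := by
  obtain ⟨c, hc, hc0, h⟩ := hp
  obtain ⟨c', hc', hc0', h'⟩ := hq
  refine ⟨c * c', D.mul_mem hc hc', mul_ne_zero hc0 hc0', fun s hs => ?_⟩
  obtain ⟨e, he, h1⟩ := h (c' * s) (D.mul_mem hc' hs)
  obtain ⟨e', he', h2⟩ := h' (c * s) (D.mul_mem hc hs)
  refine ⟨c' * e + c * e', D.add_mem (D.mul_mem hc' he) (D.mul_mem hc he'), ?_⟩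
  rw [eval_add, eval_add]
  rw [show r + c * c' * s = r + c * (c' * s) by ring, h1,
    show r + c * (c' * s) = r + c' * (c * s) by ring, h2]
  ring

lemma locExp_mul {K : Type*} [Field K] {D : Subring K}
    (hfrac : ∀ x : K, ∃ a b : K, a ∈ D ∧ b ∈ D ∧ b ≠ 0 ∧ x = a / b) {r : K} {p q : K[X]}
    (hp : LocExp D r p) (hq : LocExp D r q) : LocExp D r (p * q) := by
  obtain ⟨c, hc, hc0, h⟩ := hp
  obtain ⟨c', hc', hc0', h'⟩ := hq
  obtain ⟨a, b, ha, hb, hb0, hab⟩ := hfrac (p.eval r)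
  obtain ⟨a', b', ha', hb', hb0', hab'⟩ := hfrac (q.eval r)
  refine ⟨c * c' * (b * b'), D.mul_mem (D.mul_mem hc hc') (D.mul_mem hb hb'),
    mul_ne_zero (mul_ne_zero hc0 hc0') (mul_ne_zero hb0 hb0'), fun s hs => ?_⟩
  have hbb := D.mul_mem hb hb'
  obtain ⟨e, he, h1⟩ := h (c' * (b * b') * s) (D.mul_mem (D.mul_mem hc' hbb) hs)
  obtain ⟨e', he', h2⟩ := h' (c * (b * b') * s) (D.mul_mem (D.mul_mem hc hbb) hs)
  refine ⟨a * b' * c * e' + a' * b * c' * e + s * (c' * (b * b') * e) * (c * (b * b') * e'),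
    ?_, ?_⟩
  · lift a to D using ha
    lift b to D using hb
    lift a' to D using ha'
    lift b' to D using hb'
    lift c to D using hc
    lift c' to D using hc'
    lift e to D using he
    lift e' to D using he'
    lift s to D using hs
    exact_mod_cast Subtype.property (a * b' * c * e' + a' * b * c' * e
      + s * (c' * (b * b') * e) * (c * (b * b') * e') : D)
  · rw [eval_mul, eval_mul]
    rw [show r + c * c' * (b * b') * s = r + c * (c' * (b * b') * s) by ring, h1,
      show r + c * (c' * (b * b') * s) = r + c' * (c * (b * b') * s) by ring, h2, hab, hab']
    field_simp
    ring

lemma locExp_all {K : Type*} [Field K] {D : Subring K}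
    (hfrac : ∀ x : K, ∃ a b : K, a ∈ D ∧ b ∈ D ∧ b ≠ 0 ∧ x = a / b) (r : K) (p : K[X]) :
    LocExp D r p := by
  have hC : ∀ a : K, LocExp D r (C a) := fun a =>
    ⟨1, D.one_mem, one_ne_zero, fun s _ => ⟨0, D.zero_mem, by simp⟩⟩
  have hX : LocExp D r X :=
    ⟨1, D.one_mem, one_ne_zero, fun s _ => ⟨1, D.one_mem, by simp⟩⟩
  induction p using Polynomial.induction_on with
  | C a => exact hC a
  | add p q hp hq => exact locExp_add hp hq
  | monomial n a h =>
    rw [pow_succ, ← mul_assoc]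
    exact locExp_mul hfrac h hX

/-- Let `D` be an integral domain that is not a field (realized as a subring of
its field of fractions `K`).  If a rational function `φ ∈ K(x)` is defined and `D`-valued at
all but finitely many `r ∈ K`, then `φ` is defined at every element of `K` and `D`-valued
everywhere, i.e. `φ ∈ IntR(K, D)`. -/
theorem statement0 (K : Type*) [Field K] (D : Subring K)
    (hfrac : ∀ x : K, ∃ a b : K, a ∈ D ∧ b ∈ D ∧ b ≠ 0 ∧ x = a / b)
    (hnotfield : ∃ d : K, d ∈ D ∧ d ≠ 0 ∧ d⁻¹ ∉ D)
    (φ : RatFunc K)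
    (hae : {r : K | ¬ (φ.denom.eval r ≠ 0 ∧ φ.num.eval r / φ.denom.eval r ∈ D)}.Finite) :
    ∀ r : K, φ.denom.eval r ≠ 0 ∧ φ.num.eval r / φ.denom.eval r ∈ D := by
  classical
  intro r
  obtain ⟨d, hd, hd0, hdinv⟩ := hnotfield
  have hunit : ∀ n : ℕ, ∀ w ∈ D, d ^ (n + 1) * w ≠ 1 := by
    intro n w hw h
    apply hdinv
    have : d⁻¹ = d ^ n * w := by
      apply inv_eq_of_mul_eq_one_right
      rw [← h]; ring
    rw [this]
    exact D.mul_mem (D.pow_mem hd n) hw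
  have hlt : ∀ i j : ℕ, i < j → d ^ i ≠ d ^ j := by
    intro i j hij h
    obtain ⟨k, rfl⟩ := Nat.exists_eq_add_of_lt hij
    apply hunit k 1 D.one_mem
    have h0 : d ^ i ≠ 0 := pow_ne_zero _ hd0
    apply mul_left_cancel₀ h0
    rw [mul_one, mul_one, ← pow_add, ← add_assoc, ← h]
  have hinj : Function.Injective (fun n : ℕ => d ^ n) := by
    intro i j h
    rcases lt_trichotomy i j with hij | hij | hij
    · exact absurd h (hlt i j hij)
    · exact hij
    · exact absurd h.symm (hlt j i hij)
  -- good points arbitrarily close to `r`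
  have hgood : ∀ c : K, c ≠ 0 → ∃ n : ℕ, φ.denom.eval (r + c * d ^ (n + 1)) ≠ 0 ∧
      φ.num.eval (r + c * d ^ (n + 1)) / φ.denom.eval (r + c * d ^ (n + 1)) ∈ D := by
    intro c hc
    by_contra! hcon
    have hinj2 : Function.Injective (fun n : ℕ => r + c * d ^ (n + 1)) := by
      intro i j h
      have h3 : d ^ (i + 1) = d ^ (j + 1) := mul_left_cancel₀ hc (add_left_cancel h)
      exact Nat.succ_injective (hinj h3)
    refine Set.infinite_of_injective_forall_mem hinj2 (fun n => ?_) hae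
    exact fun hh => hcon n hh.1 hh.2
  have key : ∀ u : K, ∃ n : ℕ, ∃ e ∈ D, ∃ e' ∈ D, ∃ z ∈ D,
      u * φ.num.eval r + d ^ (n + 1) * e = z * (u * φ.denom.eval r + d ^ (n + 1) * e') := by
    intro u
    obtain ⟨c, hc, hc0, h⟩ := locExp_all hfrac r (C u * φ.num)
    obtain ⟨c', hc', hc0', h'⟩ := locExp_all hfrac r (C u * φ.denom)
    obtain ⟨n, hn0, hn⟩ := hgood (c * c') (mul_ne_zero hc0 hc0')
    have hs := D.pow_mem hd (n + 1)
    obtain ⟨e, he, h1⟩ := h (c' * d ^ (n + 1)) (D.mul_mem hc' hs)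
    obtain ⟨e', he', h2⟩ := h' (c * d ^ (n + 1)) (D.mul_mem hc hs)
    refine ⟨n, c' * e, D.mul_mem hc' he, c * e', D.mul_mem hc he', _, hn, ?_⟩
    rw [show r + c * (c' * d ^ (n + 1)) = r + c * c' * d ^ (n + 1) by ring] at h1
    rw [show r + c' * (c * d ^ (n + 1)) = r + c * c' * d ^ (n + 1) by ring] at h2
    simp only [eval_mul, eval_C] at h1 h2
    rw [show u * φ.num.eval r + d ^ (n + 1) * (c' * e) =
      u * φ.num.eval r + c' * d ^ (n + 1) * e by ring, ← h1,
      show u * φ.denom.eval r + d ^ (n + 1) * (c * e') =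
      u * φ.denom.eval r + c * d ^ (n + 1) * e' by ring, ← h2]
    field_simp
  have hden : φ.denom.eval r ≠ 0 := by
    intro hz
    have hnum : φ.num.eval r ≠ 0 := by
      intro hz'
      obtain ⟨a, b, hab⟩ := φ.isCoprime_num_denom
      have := congrArg (Polynomial.eval r) hab
      simp [hz, hz'] at this
    obtain ⟨n, e, he, e', he', z, hz1, h⟩ := key (φ.num.eval r)⁻¹
    rw [hz, inv_mul_cancel₀ hnum] at h
    apply hunit n (z * e' - e) (D.sub_mem (D.mul_mem hz1 he') he)
    linear_combination -h
  refine ⟨hden, ?_⟩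
  obtain ⟨n, e, he, e', he', z, hz1, h⟩ := key (φ.denom.eval r)⁻¹
  rw [inv_mul_cancel₀ hden] at h
  have hs := D.pow_mem hd (n + 1)
  have : φ.num.eval r / φ.denom.eval r = z * (1 + d ^ (n + 1) * e') - d ^ (n + 1) * e := by
    rw [div_eq_inv_mul]
    linear_combination h
  rw [this]
  exact D.sub_mem (D.mul_mem hz1 (D.add_mem D.one_mem (D.mul_mem hs he'))) (D.mul_mem hs he)
end

section
/- Let V be a valuation domain with field of fractions K and maximal ideal 𝔪. If the residue field V/𝔪 is algebraically closed and 𝔪 is not a principal ideal of V, then the ring IntR(V) of integer-valued rational functions over V is not a Prüfer domain; indeed, for any nonzero d ∈ 𝔪, the finitely generated ideal (x, d) of IntR(V) is not invertible. -/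
open Polynomial

/-- `φ ∈ IntR(V)`: the rational function `φ ∈ K(x)` is defined at, and takes a value in `V`
at, every element of `V`. -/
def IntegerValued {K : Type*} [Field K] (V : ValuationSubring K) (φ : RatFunc K) : Prop :=
  ∀ a : K, a ∈ V → φ.denom.eval a ≠ 0 ∧ φ.num.eval a / φ.denom.eval a ∈ V

/-- A subring (given as a subset `R` of its fraction field `F`) is a Prüfer domain:
every nonzero finitely generated ideal `(a₁, …, aₙ)` is invertible, i.e. there are
`b₁, …, bₙ ∈ F` with every `bᵢaⱼ ∈ R` and `∑ bᵢaᵢ = 1`. -/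
def IsPruferSet (F : Type*) [Field F] (R : Set F) : Prop :=
  ∀ (n : ℕ) (a : Fin n → F), (∀ i, a i ∈ R) → (∃ i, a i ≠ 0) →
    ∃ b : Fin n → F, (∀ i j, b i * a j ∈ R) ∧ ∑ i, b i * a i = 1

lemma small_root {V : Type*} [CommRing V] [IsDomain V] [ValuationRing V]
    (hnp : ¬ (IsLocalRing.maximalIdeal V).IsPrincipal) (s : V) (hs : s ≠ 0)
    (hsm : s ∈ IsLocalRing.maximalIdeal V) (n : ℕ) :
    ∃ t ∈ IsLocalRing.maximalIdeal V, t ≠ 0 ∧ t ^ n ∣ s := by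
  have key : ∀ n : ℕ, ∃ t ∈ IsLocalRing.maximalIdeal V, t ≠ 0 ∧ t ^ (2 ^ n) ∣ s := by
    intro n
    induction n with
    | zero => exact ⟨s, hsm, hs, by simp⟩
    | succ n ih =>
      obtain ⟨t, htm, ht0, hts⟩ := ih
      have h1 : ∃ u ∈ IsLocalRing.maximalIdeal V, ¬ t ∣ u := by
        by_contra! hcon
        apply hnp
        refine ⟨⟨t, le_antisymm ?_ ?_⟩⟩
        · intro u hu
          exact Ideal.mem_span_singleton.2 (hcon u hu)
        · exact (Ideal.span_singleton_le_iff_mem _).2 htm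
      obtain ⟨u, hum, hu⟩ := h1
      obtain ⟨w, hw⟩ := (ValuationRing.dvd_total t u).resolve_left hu
      have hwm : w ∈ IsLocalRing.maximalIdeal V := by
        rw [IsLocalRing.mem_maximalIdeal, mem_nonunits_iff]
        rintro ⟨w', rfl⟩
        apply hu
        exact ⟨↑w'⁻¹, by rw [hw]; simp [mul_assoc]⟩
      have hu0 : u ≠ 0 := by rintro rfl; simp at hu
      have hw0 : w ≠ 0 := by rintro rfl; simp at hw; exact ht0 hw
      have h2 : ∃ a ∈ IsLocalRing.maximalIdeal V, a ≠ 0 ∧ a ^ 2 ∣ t := by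
        rcases ValuationRing.dvd_total u w with h | h
        · exact ⟨u, hum, hu0, by rw [hw, sq]; exact mul_dvd_mul_left _ h⟩
        · exact ⟨w, hwm, hw0, by rw [hw, sq]; exact mul_dvd_mul_right h _⟩
      obtain ⟨a, ham, ha0, hat⟩ := h2
      refine ⟨a, ham, ha0, ?_⟩
      rw [pow_succ', pow_mul]
      exact (pow_dvd_pow_of_dvd hat _).trans hts
  obtain ⟨t, h1, h2, h3⟩ := key n
  exact ⟨t, h1, h2, (pow_dvd_pow t Nat.lt_two_pow_self.le).trans h3⟩

lemma common_divisor {V : Type*} [CommRing V] [IsDomain V] [ValuationRing V]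
    (E F : V[X]) (s : V) (hs : s ≠ 0) (hsm : s ∈ IsLocalRing.maximalIdeal V)
    (hE : E.map (IsLocalRing.residue V) = 0) (hF : F.map (IsLocalRing.residue V) = 0) :
    ∃ r ∈ IsLocalRing.maximalIdeal V, r ≠ 0 ∧ r ∣ s ∧ (∀ a, r ∣ E.eval a) ∧
      ∀ a, r ∣ F.eval a := by
  classical
  let S : Finset V := insert s (E.coeffs ∪ F.coeffs)
  have hprin : (Ideal.span (S : Set V)).IsPrincipal :=
    IsBezout.isPrincipal_of_FG _ ⟨S, rfl⟩
  obtain ⟨r, hr⟩ := hprin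
  have hr' : Ideal.span (S : Set V) = Ideal.span {r} := hr
  have hdvd : ∀ x ∈ S, r ∣ x := by
    intro x hx
    rw [← Ideal.mem_span_singleton, ← hr']
    exact Ideal.subset_span hx
  have hco : ∀ H : V[X], H.map (IsLocalRing.residue V) = 0 →
      ∀ n, H.coeff n ∈ IsLocalRing.maximalIdeal V := by
    intro H hH n
    rw [← IsLocalRing.residue_eq_zero_iff, ← Polynomial.coeff_map, hH, Polynomial.coeff_zero]
  have hle : Ideal.span (S : Set V) ≤ IsLocalRing.maximalIdeal V := by
    rw [Ideal.span_le]
    intro x hx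
    simp only [S, Finset.coe_insert, Finset.coe_union, Set.mem_insert_iff, Set.mem_union,
      Finset.mem_coe, Polynomial.mem_coeffs_iff] at hx
    rcases hx with rfl | ⟨n, -, rfl⟩ | ⟨n, -, rfl⟩
    · exact hsm
    · exact hco E hE n
    · exact hco F hF n
  have hev : ∀ H : V[X], H.coeffs ⊆ S → ∀ a, r ∣ H.eval a := by
    intro H hH a
    rw [Polynomial.eval_eq_sum, Polynomial.sum]
    refine Finset.dvd_sum fun n hn => Dvd.dvd.mul_right (hdvd _ (hH ?_)) _
    exact Polynomial.mem_coeffs_iff.2 ⟨n, hn, rfl⟩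
  have hrs : r ∣ s := hdvd s (by simp [S])
  refine ⟨r, hle (hr' ▸ Ideal.mem_span_singleton_self r), ?_, hrs, hev E ?_, hev F ?_⟩
  · rintro rfl
    exact hs (zero_dvd_iff.1 hrs)
  · intro x hx; simp [S, hx]
  · intro x hx; simp [S, hx]

lemma local_lemma {V : Type*} [CommRing V] [IsDomain V] [ValuationRing V]
    (hnp : ¬ (IsLocalRing.maximalIdeal V).IsPrincipal) (P Q : V[X])
    (G A B : (IsLocalRing.ResidueField V)[X])
    (hP : P.map (IsLocalRing.residue V) = G * A) (hQ : Q.map (IsLocalRing.residue V) = G * B)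
    (hG : G ≠ 0) (w s : V) (hs : s ≠ 0) (hsm : s ∈ IsLocalRing.maximalIdeal V) :
    ∃ t ∈ IsLocalRing.maximalIdeal V, t ≠ 0 ∧ t ∣ s ∧ ∃ g x y : V,
      ∃ h : IsLocalRing.ResidueField V, g ≠ 0 ∧ h ≠ 0 ∧
      P.eval (w + t) = g * x ∧ Q.eval (w + t) = g * y ∧
      IsLocalRing.residue V x = h * A.eval (IsLocalRing.residue V w) ∧
      IsLocalRing.residue V y = h * B.eval (IsLocalRing.residue V w) := by
  set ρ := IsLocalRing.residue V with hρ
  obtain ⟨H, hH, hnd⟩ := Polynomial.exists_eq_pow_rootMultiplicity_mul_and_not_dvd G hG (ρ w)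
  set k := Polynomial.rootMultiplicity (ρ w) G
  have hHw : H.eval (ρ w) ≠ 0 := fun h => hnd (Polynomial.dvd_iff_isRoot.2 h)
  have hsurj := Polynomial.map_surjective ρ IsLocalRing.residue_surjective
  obtain ⟨U, hU⟩ := hsurj (H * A)
  obtain ⟨W, hW⟩ := hsurj (H * B)
  obtain ⟨r, hrm, hr0, hrs, hrE, hrF⟩ := common_divisor (P - (X - C w) ^ k * U)
    (Q - (X - C w) ^ k * W) s hs hsm
    (by rw [← hρ]; simp [hP, hU]; rw [hH]; ring) (by rw [← hρ]; simp [hQ, hW]; rw [hH]; ring)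
  obtain ⟨t, htm, ht0, htr⟩ := small_root hnp r hr0 hrm (k + 1)
  have hρt : ρ t = 0 := (IsLocalRing.residue_eq_zero_iff t).2 htm
  obtain ⟨e, he⟩ := htr.trans (hrE (w + t))
  obtain ⟨f, hf⟩ := htr.trans (hrF (w + t))
  simp only [Polynomial.eval_sub, Polynomial.eval_mul, Polynomial.eval_pow, Polynomial.eval_X,
    Polynomial.eval_C, add_sub_cancel_left] at he hf
  have hres : ∀ Z : V[X], ρ (Z.eval (w + t)) = (Z.map ρ).eval (ρ w) := by
    intro Z
    rw [← Polynomial.eval₂_at_apply, Polynomial.eval_map]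
    simp [hρt]
  refine ⟨t, htm, ht0, (Dvd.intro_left (t ^ k) (pow_succ t k).symm).trans (htr.trans hrs),
    t ^ k, U.eval (w + t) + t * e, W.eval (w + t) + t * f, H.eval (ρ w), pow_ne_zero _ ht0, hHw,
    ?_, ?_, ?_, ?_⟩
  · linear_combination he
  · linear_combination hf
  · rw [map_add, map_mul, hρt, hres, hU]; simp
  · rw [map_add, map_mul, hρt, hres, hW]; simp

lemma scaling {K : Type*} [Field K] (V : ValuationSubring K) (p q : K[X]) (hq : q ≠ 0) :
    ∃ (c : K) (P Q : V[X]), c ≠ 0 ∧ P.map V.subtype = C c * p ∧ Q.map V.subtype = C c * q ∧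
      ¬ (P.map (IsLocalRing.residue V) = 0 ∧ Q.map (IsLocalRing.residue V) = 0) := by
  classical
  have hne : (p.coeffs ∪ q.coeffs).Nonempty := by
    refine ⟨q.leadingCoeff, Finset.mem_union_right _ (Polynomial.mem_coeffs_iff.2
      ⟨q.natDegree, ?_, rfl⟩)⟩
    exact Polynomial.natDegree_mem_support_of_nonzero hq
  obtain ⟨m, hm, hmax⟩ := Finset.exists_max_image _ V.valuation hne
  have hm0 : m ≠ 0 := by
    rcases Finset.mem_union.1 hm with h | h
    all_goals
      obtain ⟨n, hn, rfl⟩ := Polynomial.mem_coeffs_iff.1 h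
      exact Polynomial.mem_support_iff.1 hn
  have lift : ∀ r : K[X], r.coeffs ⊆ p.coeffs ∪ q.coeffs →
      ∃ R : V[X], R.map V.subtype = C m⁻¹ * r := by
    intro r hr
    have : C m⁻¹ * r ∈ Polynomial.lifts V.subtype := by
      rw [Polynomial.lifts_iff_coeff_lifts]
      intro n
      rw [Polynomial.coeff_C_mul]
      have hv : m⁻¹ * r.coeff n ∈ V := by
        by_cases h0 : r.coeff n = 0
        · rw [h0, mul_zero]; exact V.zero_mem
        · rw [← V.valuation_le_one_iff, map_mul, map_inv₀]
          have := hmax _ (hr (Polynomial.mem_coeffs_iff.2 ⟨n, Polynomial.mem_support_iff.2 h0, rfl⟩))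
          have hvm : 0 < V.valuation m := by
            rw [zero_lt_iff]; exact (Valuation.ne_zero_iff _).2 hm0
          exact inv_mul_le_one_of_le₀ this hvm.le
      exact ⟨⟨_, hv⟩, rfl⟩
    obtain ⟨R, hR⟩ := this
    exact ⟨R, hR⟩
  obtain ⟨P, hP⟩ := lift p Finset.subset_union_left
  obtain ⟨Q, hQ⟩ := lift q Finset.subset_union_right
  have one : ∀ (r : K[X]) (R : V[X]), R.map V.subtype = C m⁻¹ * r → m ∈ r.coeffs →
      R.map (IsLocalRing.residue V) ≠ 0 := by
    intro r R hR hmr h0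
    obtain ⟨n, hn, hmn⟩ := Polynomial.mem_coeffs_iff.1 hmr
    have h1 := congrArg (fun z => Polynomial.coeff z n) hR
    simp only [Polynomial.coeff_map, Polynomial.coeff_C_mul, ← hmn, inv_mul_cancel₀ hm0] at h1
    have h2 : R.coeff n = 1 := Subtype.ext h1
    have h3 := congrArg (fun z => Polynomial.coeff z n) h0
    simp [Polynomial.coeff_map, h2] at h3
  refine ⟨m⁻¹, P, Q, inv_ne_zero hm0, hP, hQ, ?_⟩
  rintro ⟨h1, h2⟩
  rcases Finset.mem_union.1 hm with h | h
  · exact one p P hP h h1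
  · exact one q Q hQ h h2

lemma core {K : Type*} [Field K] (V : ValuationSubring K)
    (halg : IsAlgClosed (IsLocalRing.ResidueField ↥V))
    (hnp : ¬ (IsLocalRing.maximalIdeal ↥V).IsPrincipal)
    (d : V) (hd : d ≠ 0) (hdm : d ∈ IsLocalRing.maximalIdeal ↥V)
    (p q : K[X]) (hq : q ≠ 0)
    (h : ∀ a : V, ∃ r : V, p.eval (a : K) = r * q.eval (a : K) ∧
      (∀ t : V, t ≠ 0 → t ∈ IsLocalRing.maximalIdeal V → a = d * t →
        IsLocalRing.residue V r = 0) ∧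
      (∀ t : V, t ≠ 0 → t ∈ IsLocalRing.maximalIdeal V → a * t = d →
        IsLocalRing.residue V r = 1)) : False := by
  classical
  set ρ := IsLocalRing.residue V with hρ
  have hdK : (d : K) ≠ 0 := fun h => hd (Subtype.ext h)
  have hq' : q.comp (C (d : K) * X) ≠ 0 := by
    intro h0
    rw [Polynomial.comp_C_mul_X_eq_zero_iff (mem_nonZeroDivisors_of_ne_zero hdK)] at h0
    exact hq h0
  obtain ⟨c, P, Q, hc, hP, hQ, hPQ⟩ := scaling V (p.comp (C (d : K) * X)) _ hq'
  have hPe : ∀ z : K, P.eval₂ V.subtype z = c * p.eval (d * z) := by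
    intro z; rw [← Polynomial.eval_map, hP]; simp
  have hQe : ∀ z : K, Q.eval₂ V.subtype z = c * q.eval (d * z) := by
    intro z; rw [← Polynomial.eval_map, hQ]; simp
  have hPe' : ∀ z : V, ((P.eval z : V) : K) = c * p.eval (d * z : K) := by
    intro z
    rw [← hPe]; exact (Polynomial.eval₂_at_apply V.subtype z).symm
  have hQe' : ∀ z : V, ((Q.eval z : V) : K) = c * q.eval (d * z : K) := by
    intro z
    rw [← hQe]; exact (Polynomial.eval₂_at_apply V.subtype z).symm
  -- gcd decomposition
  obtain ⟨G, A, B, hG, hPG, hQG, hcop⟩ : ∃ G A B : (IsLocalRing.ResidueField V)[X], G ≠ 0 ∧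
      P.map ρ = G * A ∧ Q.map ρ = G * B ∧ IsCoprime A B := by
    have hg : EuclideanDomain.gcd (P.map ρ) (Q.map ρ) ≠ 0 := by
      intro h0; exact hPQ (EuclideanDomain.gcd_eq_zero_iff.1 h0)
    obtain ⟨A, hA⟩ := EuclideanDomain.gcd_dvd_left (P.map ρ) (Q.map ρ)
    obtain ⟨B, hB⟩ := EuclideanDomain.gcd_dvd_right (P.map ρ) (Q.map ρ)
    refine ⟨_, A, B, hg, hA, hB, ?_⟩
    have hb := EuclideanDomain.gcd_eq_gcd_ab (P.map ρ) (Q.map ρ)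
    refine ⟨EuclideanDomain.gcdA (P.map ρ) (Q.map ρ), EuclideanDomain.gcdB (P.map ρ) (Q.map ρ), ?_⟩
    apply mul_left_cancel₀ hg
    set g := EuclideanDomain.gcd (P.map ρ) (Q.map ρ)
    set u := EuclideanDomain.gcdA (P.map ρ) (Q.map ρ)
    set v := EuclideanDomain.gcdB (P.map ρ) (Q.map ρ)
    linear_combination -hb - u * hA - v * hB
  -- finite points
  have fin : ∀ w : V, ∃ t : V, t ≠ 0 ∧ t ∈ IsLocalRing.maximalIdeal V ∧ ∃ r : V,
      p.eval ((d * (w + t) : V) : K) = r * q.eval ((d * (w + t) : V) : K) ∧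
      A.eval (ρ w) = ρ r * B.eval (ρ w) ∧ (w = 0 → ρ r = 0) := by
    intro w
    obtain ⟨t, htm, ht0, -, g, x, y, e, hg, he, hx, hy, hx', hy'⟩ :=
      local_lemma hnp P Q G A B hPG hQG hG w d hd hdm
    obtain ⟨r, hr, hr0, -⟩ := h (d * (w + t))
    refine ⟨t, ht0, htm, r, hr, ?_, ?_⟩
    · have h1 : g * x = g * (r * y) := by
        have : P.eval (w + t) = r * Q.eval (w + t) := by
          apply Subtype.ext
          have e1 := hPe' (w + t)
          have e2 := hQe' (w + t)
          push_cast at e1 e2 hr ⊢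
          rw [e1, e2, hr]; ring
        rw [hx, hy] at this
        rw [this]; ring
      have h2 := congrArg ρ (mul_left_cancel₀ hg h1)
      rw [map_mul, hx', hy'] at h2
      apply mul_left_cancel₀ he
      rw [h2]; ring
    · rintro rfl
      exact hr0 t ht0 htm (by simp)
  -- B has no root
  have hBroot : ∀ z, B.eval z ≠ 0 := by
    intro z hz
    obtain ⟨w, rfl⟩ := IsLocalRing.residue_surjective z
    obtain ⟨t, -, -, r, -, hA, -⟩ := fin w
    rw [hρ, hz, mul_zero] at hA
    obtain ⟨u, v, huv⟩ := hcop
    have := congrArg (Polynomial.eval (IsLocalRing.residue V w)) huv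
    simp [hA, hz] at this
  have hBdeg : B.natDegree = 0 := by
    by_contra hne
    obtain ⟨z, hz⟩ := IsAlgClosed.exists_root B (fun h0 => hne (Polynomial.natDegree_eq_of_degree_eq_some h0))
    exact hBroot z hz
  have hA0 : A.eval 0 = 0 := by
    obtain ⟨t, -, -, r, -, hA, hr⟩ := fin 0
    rw [hr rfl, map_zero, zero_mul] at hA
    exact hA
  -- infinity
  set M := A.natDegree with hM
  set n := max G.natDegree (max P.natDegree Q.natDegree) with hn
  have hB0 : B ≠ 0 := by rintro rfl; exact hBroot 0 (by simp)
  have hinf : A.coeff M = B.coeff M := by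
    have hPr : (P.reflect (n + M)).map ρ = G.reflect n * A.reflect M := by
      rw [← Polynomial.reflect_map, hPG, Polynomial.reflect_mul _ _ (le_max_left _ _) le_rfl]
    have hQr : (Q.reflect (n + M)).map ρ = G.reflect n * B.reflect M := by
      rw [← Polynomial.reflect_map, hQG, Polynomial.reflect_mul _ _ (le_max_left _ _) (by omega)]
    have hGr : G.reflect n ≠ 0 := by rwa [Ne, Polynomial.reflect_eq_zero_iff]
    obtain ⟨t, htm, ht0, ⟨a, hta⟩, g, x, y, e, hg, he, hx, hy, hx', hy'⟩ :=
      local_lemma hnp _ _ _ _ _ hPr hQr hGr 0 d hd hdm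
    have htK : (t : K) ≠ 0 := fun h => ht0 (Subtype.ext h)
    obtain ⟨r, hr, -, hr1⟩ := h a
    have hr1 := hr1 t ht0 htm (by rw [hta]; ring)
    have hda : (d : K) * (t : K)⁻¹ = a := by
      rw [hta]; push_cast; field_simp
    let _ : Invertible ((t : K)⁻¹) := ⟨t, by field_simp, by field_simp⟩
    have inve : ⅟((t : K)⁻¹) = t := rfl
    have refl : ∀ (R : V[X]), R.natDegree ≤ n + M →
        (((R.reflect (n + M)).eval t : V) : K) * (t : K)⁻¹ ^ (n + M) =
          R.eval₂ V.subtype (t : K)⁻¹ := by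
      intro R hR
      rw [← Polynomial.eval₂_reflect_mul_pow V.subtype (t : K)⁻¹ _ R hR, inve]
      congr 1
      exact (Polynomial.eval₂_at_apply V.subtype t).symm
    have e1 := refl P (by omega)
    have e2 := refl Q (by omega)
    rw [hPe, hda, hr] at e1
    rw [hQe, hda] at e2
    rw [zero_add] at hx hy
    have h1 : g * x = g * (r * y) := by
      have : (P.reflect (n + M)).eval t = r * (Q.reflect (n + M)).eval t := by
        apply Subtype.ext
        push_cast
        have hpow : ((t : K)⁻¹ ^ (n + M)) ≠ 0 := pow_ne_zero _ (inv_ne_zero htK)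
        apply mul_right_cancel₀ hpow
        rw [e1, mul_assoc, e2]; ring
      rw [hx, hy] at this
      rw [this]; ring
    have h2 := congrArg ρ (mul_left_cancel₀ hg h1)
    rw [map_mul, hr1, one_mul, hx', hy'] at h2
    have h3 := mul_left_cancel₀ he h2
    simpa [← Polynomial.coeff_zero_eq_eval_zero, Polynomial.coeff_reflect,
      Polynomial.revAt_le] using h3
  by_cases hM0 : M = 0
  · have hAC := Polynomial.eq_C_of_natDegree_eq_zero (hM ▸ hM0 : A.natDegree = 0)
    rw [Polynomial.eval_eq_sum_range] at hA0
    rw [← hM, hM0] at hA0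
    rw [hM0] at hinf
    simp at hA0
    apply hBroot 0
    rw [← Polynomial.coeff_zero_eq_eval_zero, ← hinf, hA0]
  · rw [Polynomial.coeff_eq_zero_of_natDegree_lt (by omega : B.natDegree < M)] at hinf
    have : A = 0 := Polynomial.leadingCoeff_eq_zero.1 hinf
    apply hM0; rw [hM, this]; simp

lemma part_one {K : Type*} [Field K] (V : ValuationSubring K)
    (halg : IsAlgClosed (IsLocalRing.ResidueField ↥V))
    (hnp : ¬ (IsLocalRing.maximalIdeal ↥V).IsPrincipal) :
    ∀ d : ↥V, d ≠ 0 → d ∈ IsLocalRing.maximalIdeal ↥V →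
      ¬ ∃ φ ψ : RatFunc K,
        IntegerValued V (φ * RatFunc.X) ∧ IntegerValued V (φ * RatFunc.C (d : K)) ∧
        IntegerValued V (ψ * RatFunc.X) ∧ IntegerValued V (ψ * RatFunc.C (d : K)) ∧
        RatFunc.X * φ + RatFunc.C (d : K) * ψ = 1 := by
  rintro d hd hdm ⟨φ, ψ, h1, h2, h3, h4, h5⟩
  have hdK : (d : K) ≠ 0 := fun h => hd (Subtype.ext h)
  refine core V halg hnp d hd hdm (φ * RatFunc.X).num (φ * RatFunc.X).denom
    (RatFunc.denom_ne_zero _) ?_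
  intro a
  have conv : ∀ θ : RatFunc K, IntegerValued V θ → ∃ r : V,
      θ.eval (RingHom.id K) (a : K) = r ∧ θ.denom.eval₂ (RingHom.id K) (a : K) ≠ 0 := by
    intro θ hθ
    obtain ⟨u1, u2⟩ := hθ a a.2
    exact ⟨⟨_, u2⟩, rfl, u1⟩
  obtain ⟨r1, e1, n1⟩ := conv _ h1
  obtain ⟨r2, e2, n2⟩ := conv _ h2
  obtain ⟨r3, e3, n3⟩ := conv _ h3
  obtain ⟨r4, e4, n4⟩ := conv _ h4
  have nX : (RatFunc.X : RatFunc K).denom.eval₂ (RingHom.id K) (a : K) ≠ 0 := by simp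
  have nC : (RatFunc.C (d : K) : RatFunc K).denom.eval₂ (RingHom.id K) (a : K) ≠ 0 := by simp
  have f1 : r2 * a = r1 * d := by
    apply Subtype.ext
    push_cast
    have : φ * RatFunc.C (d : K) * RatFunc.X = φ * RatFunc.X * RatFunc.C (d : K) := by ring
    have := congrArg (RatFunc.eval (RingHom.id K) (a : K)) this
    rw [RatFunc.eval_mul _ _ n2 nX, RatFunc.eval_mul _ _ n1 nC, e1, e2] at this
    simpa using this
  have f2 : r4 * a = r3 * d := by
    apply Subtype.ext
    push_cast
    have : ψ * RatFunc.C (d : K) * RatFunc.X = ψ * RatFunc.X * RatFunc.C (d : K) := by ring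
    have := congrArg (RatFunc.eval (RingHom.id K) (a : K)) this
    rw [RatFunc.eval_mul _ _ n4 nX, RatFunc.eval_mul _ _ n3 nC, e3, e4] at this
    simpa using this
  have f3 : r1 + r4 = 1 := by
    apply Subtype.ext
    push_cast
    have : φ * RatFunc.X + ψ * RatFunc.C (d : K) = 1 := by rw [← h5]; ring
    have := congrArg (RatFunc.eval (RingHom.id K) (a : K)) this
    rw [RatFunc.eval_add _ _ n1 n4, e1, e4] at this
    simpa using this
  refine ⟨r1, ?_, ?_, ?_⟩
  · rw [← e1]
    exact (div_mul_cancel₀ _ n1).symm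
  · intro t ht0 htm hat
    have : r1 = r2 * t := by
      apply mul_right_cancel₀ hd
      rw [← f1, hat]; ring
    rw [this, map_mul, (IsLocalRing.residue_eq_zero_iff t).2 htm, mul_zero]
  · intro t ht0 htm hat
    have ha0 : a ≠ 0 := by rintro rfl; apply hd; rw [← hat]; simp
    have : r4 = r3 * t := by
      apply mul_right_cancel₀ ha0
      rw [f2, ← hat]; ring
    have h6 := congrArg (IsLocalRing.residue V) f3
    rw [this, map_add, map_mul, (IsLocalRing.residue_eq_zero_iff t).2 htm, mul_zero, add_zero,
      map_one] at h6
    exact h6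

/-- Let `V` be a valuation domain with fraction field `K` and maximal ideal
`𝔪`.  If the residue field `V/𝔪` is algebraically closed and `𝔪` is not principal, then for
every nonzero `d ∈ 𝔪` the finitely generated ideal `(x, d)` of `IntR(V)` is not invertible;
in particular `IntR(V)` is not a Prüfer domain. -/
theorem statement12 (K : Type*) [Field K] (V : ValuationSubring K)
    (halg : IsAlgClosed (IsLocalRing.ResidueField ↥V))
    (hnp : ¬ (IsLocalRing.maximalIdeal ↥V).IsPrincipal) :
    (∀ d : ↥V, d ≠ 0 → d ∈ IsLocalRing.maximalIdeal ↥V →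
      ¬ ∃ φ ψ : RatFunc K,
        IntegerValued V (φ * RatFunc.X) ∧ IntegerValued V (φ * RatFunc.C (d : K)) ∧
        IntegerValued V (ψ * RatFunc.X) ∧ IntegerValued V (ψ * RatFunc.C (d : K)) ∧
        RatFunc.X * φ + RatFunc.C (d : K) * ψ = 1) ∧
    ¬ IsPruferSet (RatFunc K) {φ | IntegerValued V φ} := by
  refine ⟨part_one V halg hnp, ?_⟩
  intro hpr
  have hne : IsLocalRing.maximalIdeal V ≠ ⊥ := by
    intro h0
    apply hnp
    rw [h0]
    exact bot_isPrincipal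
  obtain ⟨d, hdm, hd⟩ := Submodule.exists_mem_ne_zero_of_ne_bot hne
  obtain ⟨b, hb, hsum⟩ := hpr 2 ![RatFunc.X, RatFunc.C (d : K)] (by
    intro i
    fin_cases i
    · intro a ha
      simpa using ha
    · intro a ha
      simp) ⟨0, by simpa using RatFunc.X_ne_zero⟩
  refine part_one V halg hnp d hd hdm ⟨b 0, b 1, hb 0 0, hb 0 1, hb 1 0, hb 1 1, ?_⟩
  rw [Fin.sum_univ_two] at hsum
  simp only [Matrix.cons_val_zero, Matrix.cons_val_one] at hsum
  rw [← hsum]; ring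
end

section
/- Let V be a valuation domain with maximal ideal 𝔪. Then the ring IntR(V) of integer-valued rational functions over V is a Prüfer domain if and only if the residue field V/𝔪 is not algebraically closed or 𝔪 is a principal ideal of V. -/
open Polynomial

/-- Pairs suffice. -/
lemma isPruferSet_of_pairs {F : Type*} [Field F] (R : Subring F)
    (h : ∀ x : F, ∃ u w : F, u ∈ R ∧ w ∈ R ∧ u * x ∈ R ∧ w * x ∈ R ∧ u * x + w = 1) :
    IsPruferSet F (R : Set F) := by
  intro n
  induction n with
  | zero => rintro a - ⟨i, -⟩; exact i.elim0
  | succ n ih =>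
    intro a ha hne
    simp only [SetLike.mem_coe] at *
    by_cases hz : a 0 = 0
    · obtain ⟨i, hi⟩ := hne
      obtain ⟨j, rfl⟩ : ∃ j : Fin n, i = j.succ :=
        Fin.exists_succ_eq.mpr (by rintro rfl; exact hi hz) |>.imp fun _ h => h.symm
      obtain ⟨b, hb, hs⟩ := ih (fun j => a j.succ) (fun j => ha _) ⟨j, hi⟩
      refine ⟨Fin.cons 0 b, ?_, ?_⟩
      · intro i j
        refine Fin.cases ?_ (fun i => ?_) i
        · simp [R.zero_mem]
        · refine Fin.cases ?_ (fun j => ?_) j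
          · simp [hz, R.zero_mem]
          · simpa using hb i j
      · simpa [Fin.sum_univ_succ] using hs
    · by_cases hall : ∃ j : Fin n, a j.succ ≠ 0
      · obtain ⟨b, hb, hs⟩ := ih (fun j => a j.succ) (fun j => ha _) hall
        choose u w hu hw hux hwx huw using fun j : Fin n => h (a j.succ / a 0)
        refine ⟨Fin.cons (∑ j, b j * a j.succ * w j / a 0)
          (fun j => b j * a j.succ * u j / a 0), ?_, ?_⟩
        · intro i j
          refine Fin.cases ?_ (fun i => ?_) i
          · simp only [Fin.cons_zero, Finset.sum_mul]
            refine R.sum_mem fun i _ => ?_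
            refine Fin.cases ?_ (fun j => ?_) j
            · have : b i * a i.succ * w i / a 0 * a 0 = b i * a i.succ * w i := by field_simp
              rw [this]; exact R.mul_mem (hb i i) (hw i)
            · have : b i * a i.succ * w i / a 0 * a j.succ
                = (b i * a j.succ) * (w i * (a i.succ / a 0)) := by field_simp
              rw [this]; exact R.mul_mem (hb i j) (hwx i)
          · simp only [Fin.cons_succ]
            refine Fin.cases ?_ (fun j => ?_) j
            · have : b i * a i.succ * u i / a 0 * a 0 = b i * a i.succ * u i := by field_simp
              rw [this]; exact R.mul_mem (hb i i) (hu i)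
            · have : b i * a i.succ * u i / a 0 * a j.succ
                = (b i * a j.succ) * (u i * (a i.succ / a 0)) := by field_simp
              rw [this]; exact R.mul_mem (hb i j) (hux i)
        · rw [Fin.sum_univ_succ]
          simp only [Fin.cons_zero, Fin.cons_succ]
          rw [Finset.sum_mul, ← Finset.sum_add_distrib, ← hs]
          refine Finset.sum_congr rfl fun j _ => ?_
          have : b j * a j.succ * w j / a 0 * a 0 + b j * a j.succ * u j / a 0 * a j.succ
            = b j * a j.succ * (u j * (a j.succ / a 0) + w j) := by field_simp; ring
          rw [this, huw, mul_one]
      · push Not at hall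
        refine ⟨Fin.cons (a 0)⁻¹ 0, ?_, ?_⟩
        · intro i j
          refine Fin.cases ?_ (fun i => ?_) i
          · refine Fin.cases ?_ (fun j => ?_) j
            · simp [hz, R.one_mem]
            · simp [hall, R.zero_mem]
          · simp [R.zero_mem]
        · simp [Fin.sum_univ_succ, hz]

section
variable {K : Type*} [Field K]

lemma mul_denom_eq (φ : RatFunc K) :
    φ * algebraMap K[X] (RatFunc K) φ.denom = algebraMap K[X] (RatFunc K) φ.num := by
  have hd : algebraMap K[X] (RatFunc K) φ.denom ≠ 0 :=
    RatFunc.algebraMap_ne_zero φ.denom_ne_zero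
  exact ((div_eq_iff hd).1 (RatFunc.num_div_denom φ)).symm

/-- `φ` is represented at `c` by a fraction with value `y`. -/
lemma repr_iff (c y : K) (φ : RatFunc K) :
    (φ.denom.eval c ≠ 0 ∧ φ.num.eval c / φ.denom.eval c = y) ↔
    ∃ P Q : K[X], Q.eval c ≠ 0 ∧ φ * algebraMap K[X] (RatFunc K) Q = algebraMap K[X] (RatFunc K) P ∧
      P.eval c = y * Q.eval c := by
  have hd : algebraMap K[X] (RatFunc K) φ.denom ≠ 0 :=
    RatFunc.algebraMap_ne_zero φ.denom_ne_zero
  constructor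
  · rintro ⟨h1, h2⟩
    refine ⟨φ.num, φ.denom, h1, ?_, ?_⟩
    · exact mul_denom_eq φ
    · rw [← h2]; field_simp
  · rintro ⟨P, Q, hQ, h, hv⟩
    have h' : φ.num * Q = P * φ.denom := by
      apply RatFunc.algebraMap_injective K
      rw [map_mul, map_mul, ← h]
      rw [← mul_denom_eq φ]; ring
    have hne : φ.denom.eval c ≠ 0 := by
      have : φ.denom ∣ Q := by
        have : φ.denom ∣ φ.num * Q := ⟨P, by rw [h']; ring⟩
        exact (RatFunc.isCoprime_num_denom φ).symm.dvd_of_dvd_mul_left this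
      obtain ⟨D, rfl⟩ := this
      rw [eval_mul] at hQ
      exact left_ne_zero_of_mul hQ
    refine ⟨hne, ?_⟩
    have := congrArg (eval c) h'
    rw [eval_mul, eval_mul, hv] at this
    field_simp
    apply mul_right_cancel₀ hQ
    rw [this]; ring

/-- `φ` has the value `y` at `c`. -/
def HasVal (c : K) (φ : RatFunc K) (y : K) : Prop :=
  φ.denom.eval c ≠ 0 ∧ φ.num.eval c / φ.denom.eval c = y

lemma HasVal.add {c : K} {φ ψ : RatFunc K} {y z : K} (h : HasVal c φ y) (h' : HasVal c ψ z) :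
    HasVal c (φ + ψ) (y + z) := by
  unfold HasVal at *
  rw [repr_iff] at *
  obtain ⟨P, Q, h1, h2, h3⟩ := h
  obtain ⟨P', Q', h1', h2', h3'⟩ := h'
  refine ⟨P * Q' + P' * Q, Q * Q', by simp [h1, h1'], ?_, ?_⟩
  · simp only [map_mul, map_add, ← h2, ← h2']; ring
  · simp only [eval_mul, eval_add, h3, h3']; ring

lemma HasVal.mul {c : K} {φ ψ : RatFunc K} {y z : K} (h : HasVal c φ y) (h' : HasVal c ψ z) :
    HasVal c (φ * ψ) (y * z) := by
  unfold HasVal at *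
  rw [repr_iff] at *
  obtain ⟨P, Q, h1, h2, h3⟩ := h
  obtain ⟨P', Q', h1', h2', h3'⟩ := h'
  refine ⟨P * P', Q * Q', by simp [h1, h1'], ?_, ?_⟩
  · simp only [map_mul, ← h2, ← h2']; ring
  · simp only [eval_mul, h3, h3']; ring

lemma HasVal.poly (c : K) (P : K[X]) : HasVal c (algebraMap K[X] (RatFunc K) P) (P.eval c) := by
  unfold HasVal
  rw [repr_iff]
  exact ⟨P, 1, by simp, by simp, by simp⟩

lemma HasVal.inv {c : K} {φ : RatFunc K} {y : K} (h : HasVal c φ y) (hy : y ≠ 0) :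
    HasVal c φ⁻¹ y⁻¹ := by
  unfold HasVal at *
  rw [repr_iff] at *
  obtain ⟨P, Q, h1, h2, h3⟩ := h
  have hP : P.eval c ≠ 0 := by rw [h3]; exact mul_ne_zero hy h1
  have hP0 : P ≠ 0 := by rintro rfl; simp at hP
  have hφ : φ ≠ 0 := by
    rintro rfl
    rw [zero_mul, eq_comm] at h2
    exact RatFunc.algebraMap_ne_zero hP0 h2
  refine ⟨Q, P, hP, ?_, ?_⟩
  · rw [← h2]; field_simp
  · rw [h3]; field_simp

lemma HasVal.unique {c : K} {φ : RatFunc K} {y z : K} (h : HasVal c φ y) (h' : HasVal c φ z) :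
    y = z := h.2.symm.trans h'.2

lemma HasVal.const (c y : K) : HasVal c (RatFunc.C y) y := by
  simpa using HasVal.poly c (C y)

/-- The valuation ring of rational functions that are defined and `V`-valued at `c`. -/
def Wring (V : ValuationSubring K) (c : K) : ValuationSubring (RatFunc K) where
  carrier := {φ | ∃ y ∈ V, HasVal c φ y}
  mul_mem' := by
    rintro a b ⟨y, hy, h⟩ ⟨z, hz, h'⟩
    exact ⟨_, V.mul_mem _ _ hy hz, h.mul h'⟩
  one_mem' := ⟨1, V.one_mem, by simpa using HasVal.const c (1 : K)⟩
  add_mem' := by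
    rintro a b ⟨y, hy, h⟩ ⟨z, hz, h'⟩
    exact ⟨_, V.add_mem _ _ hy hz, h.add h'⟩
  zero_mem' := ⟨0, V.zero_mem, by simpa using HasVal.const c (0 : K)⟩
  neg_mem' := by
    rintro a ⟨y, hy, h⟩
    refine ⟨-y, V.neg_mem _ hy, ?_⟩
    have := (HasVal.const c (-1 : K)).mul h
    simpa using this
  mem_or_inv_mem' := by
    intro φ
    by_cases hd : φ.denom.eval c = 0
    · right
      refine ⟨0, V.zero_mem, ?_⟩
      have hn : φ.num.eval c ≠ 0 := by
        intro hn
        obtain ⟨a, b, hab⟩ := RatFunc.isCoprime_num_denom φ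
        have := congrArg (eval c) hab
        simp [hn, hd] at this
      have := (HasVal.poly c φ.denom).mul ((HasVal.poly c φ.num).inv hn)
      rw [hd, zero_mul] at this
      convert this using 1
      conv_lhs => rw [← RatFunc.num_div_denom φ]
      rw [inv_div, div_eq_mul_inv]
    · have h : HasVal c φ (φ.num.eval c / φ.denom.eval c) := ⟨hd, rfl⟩
      rcases V.mem_or_inv_mem (φ.num.eval c / φ.denom.eval c) with h' | h'
      · exact Or.inl ⟨_, h', h⟩
      · by_cases h0 : φ.num.eval c / φ.denom.eval c = 0
        · exact Or.inl ⟨_, by rw [h0]; exact V.zero_mem, h⟩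
        · exact Or.inr ⟨_, h', h.inv h0⟩

lemma mem_Wring {V : ValuationSubring K} {c : K} {φ : RatFunc K} :
    φ ∈ Wring V c ↔ ∃ y ∈ V, HasVal c φ y := Iff.rfl

lemma integerValued_iff {V : ValuationSubring K} {φ : RatFunc K} :
    IntegerValued V φ ↔ ∀ c ∈ V, φ ∈ Wring V c := by
  refine forall₂_congr fun c _ => ?_
  rw [mem_Wring]
  constructor
  · rintro ⟨h1, h2⟩; exact ⟨_, h2, h1, rfl⟩
  · rintro ⟨y, hy, h1, h2⟩; exact ⟨h1, h2 ▸ hy⟩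

/-- `IntR(V)` as a subring. -/
def IntRSub (V : ValuationSubring K) : Subring (RatFunc K) where
  carrier := {φ | IntegerValued V φ}
  mul_mem' := by
    intro a b ha hb
    simp only [Set.mem_ofPred_eq, integerValued_iff] at *
    exact fun c hc => (Wring V c).mul_mem _ _ (ha c hc) (hb c hc)
  one_mem' := by
    simp only [Set.mem_ofPred_eq, integerValued_iff]
    exact fun c hc => (Wring V c).one_mem
  add_mem' := by
    intro a b ha hb
    simp only [Set.mem_ofPred_eq, integerValued_iff] at *
    exact fun c hc => (Wring V c).add_mem _ _ (ha c hc) (hb c hc)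
  zero_mem' := by
    simp only [Set.mem_ofPred_eq, integerValued_iff]
    exact fun c hc => (Wring V c).zero_mem
  neg_mem' := by
    intro a ha
    simp only [Set.mem_ofPred_eq, integerValued_iff] at *
    exact fun c hc => (Wring V c).neg_mem _ (ha c hc)

lemma mem_IntRSub {V : ValuationSubring K} {φ : RatFunc K} :
    φ ∈ IntRSub V ↔ ∀ c ∈ V, φ ∈ Wring V c := integerValued_iff

/-- If the value at `c` is a unit of `V`, the inverse lies in the ring too. -/
lemma inv_mem_Wring {V : ValuationSubring K} {c y : K} {φ : RatFunc K} (h : HasVal c φ y)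
    (hy0 : y ≠ 0) (hy : y⁻¹ ∈ V) : φ⁻¹ ∈ Wring V c := ⟨_, hy, h.inv hy0⟩

/-- Trivially valued case. -/
lemma prufer_top (V : ValuationSubring K) (hV : ∀ x : K, x ∈ V) :
    IsPruferSet (RatFunc K) (IntRSub V : Set (RatFunc K)) := by
  apply isPruferSet_of_pairs
  intro x
  have hP : ∀ P : K[X], algebraMap K[X] (RatFunc K) P ∈ IntRSub V := fun P =>
    mem_IntRSub.2 fun c _ => ⟨_, hV _, HasVal.poly c P⟩
  obtain ⟨a, b, hab⟩ := RatFunc.isCoprime_num_denom x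
  have hd : algebraMap K[X] (RatFunc K) x.denom ≠ 0 :=
    RatFunc.algebraMap_ne_zero x.denom_ne_zero
  have hx : algebraMap K[X] (RatFunc K) x.denom * x = algebraMap K[X] (RatFunc K) x.num := by
    rw [mul_comm, mul_denom_eq]
  have e1 : algebraMap K[X] (RatFunc K) (a * x.denom) * x = algebraMap K[X] (RatFunc K) (a * x.num) := by
    rw [map_mul, mul_assoc, hx, map_mul]
  have e2 : algebraMap K[X] (RatFunc K) (b * x.denom) * x = algebraMap K[X] (RatFunc K) (b * x.num) := by
    rw [map_mul, mul_assoc, hx, map_mul]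
  refine ⟨algebraMap _ _ (a * x.denom), algebraMap _ _ (b * x.denom), hP _, hP _,
    by rw [e1]; exact hP _, by rw [e2]; exact hP _, ?_⟩
  rw [e1, ← map_add, hab, map_one]

/-- Principal maximal ideal, nonzero generator. -/
lemma prufer_principal (V : ValuationSubring K) (t : K) (ht0 : t ≠ 0) (ht : t ∈ V)
    (ht1 : t⁻¹ ∉ V) (hm : ∀ z ∈ V, z⁻¹ ∉ V → z / t ∈ V) :
    IsPruferSet (RatFunc K) (IntRSub V : Set (RatFunc K)) := by
  apply isPruferSet_of_pairs
  intro x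
  set T : RatFunc K := RatFunc.C t with hT
  have hT0 : T ≠ 0 := by simpa [hT] using ht0
  suffices H : ∀ c ∈ V, x ^ 2 + T ≠ 0 ∧ T / (x ^ 2 + T) ∈ Wring V c ∧
      T / (x ^ 2 + T) * x ∈ Wring V c ∧ x / (x ^ 2 + T) ∈ Wring V c by
    have hne := (H 0 V.zero_mem).1
    have hs : x / (x ^ 2 + T) * x + T / (x ^ 2 + T) = 1 := by field_simp
    have hw : T / (x ^ 2 + T) ∈ IntRSub V := mem_IntRSub.2 fun c hc => (H c hc).2.1
    refine ⟨x / (x ^ 2 + T), T / (x ^ 2 + T), mem_IntRSub.2 fun c hc => (H c hc).2.2.2, hw,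
      ?_, mem_IntRSub.2 fun c hc => (H c hc).2.2.1, hs⟩
    rw [eq_sub_of_add_eq hs]
    exact (IntRSub V).sub_mem (IntRSub V).one_mem hw
  intro c hc
  set W := Wring V c with hW
  set v := W.valuation with hv
  have hvT0 : 0 < v T := zero_lt_iff.2 (by simpa using hT0)
  have hTle : ∀ z, v z < 1 → v z ≤ v T := by
    intro z hz
    by_cases hz0 : z = 0
    · simp [hz0]
    obtain ⟨y, hy, hzy⟩ := (W.valuation_le_one_iff z).1 hz.le
    have hyt : y / t ∈ V := by
      by_cases hy0 : y = 0
      · simp [hy0, V.zero_mem]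
      apply hm y hy
      intro hyi
      have := (W.valuation_le_one_iff _).2 (inv_mem_Wring hzy hy0 hyi)
      rw [map_inv₀, ← hv] at this
      have h2 := (one_lt_inv₀ (zero_lt_iff.2 (by simpa using hz0))).2 hz
      exact absurd this (not_le.2 h2)
    have : z * T⁻¹ ∈ W := ⟨y * t⁻¹, by simpa [div_eq_mul_inv] using hyt,
      hzy.mul ((HasVal.const c t).inv ht0)⟩
    have := (W.valuation_le_one_iff _).2 this
    rw [map_mul, map_inv₀, ← hv] at this
    rwa [← div_eq_mul_inv, div_le_one₀ hvT0] at this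
  have hT1 : v T < 1 := by
    refine lt_of_le_of_ne ((W.valuation_le_one_iff _).2 ⟨t, ht, HasVal.const c t⟩) fun h => ?_
    have : T⁻¹ ∈ W := (W.valuation_le_one_iff _).1 (by rw [map_inv₀, ← hv, h, inv_one])
    obtain ⟨y, hy, hty⟩ := this
    exact ht1 ((hty.unique ((HasVal.const c t).inv ht0)) ▸ hy)
  rw [← W.valuation_le_one_iff, ← W.valuation_le_one_iff, ← W.valuation_le_one_iff, ← hv]
  simp only [map_div₀, map_mul]
  rcases lt_or_ge (v x) 1 with hx | hx
  · have hxT := hTle x hx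
    have hlt : v (x ^ 2) < v T := by
      rw [map_pow, pow_two]
      calc v x * v x ≤ v T * v x := mul_le_mul_left hxT _
        _ < v T * 1 := by gcongr
        _ = v T := mul_one _
    have hs : v (x ^ 2 + T) = v T := Valuation.map_add_eq_of_lt_right _ hlt
    refine ⟨fun h => ?_, ?_, ?_, ?_⟩
    · rw [h, map_zero] at hs; exact hvT0.ne hs
    · rw [hs, div_self hvT0.ne']
    · rw [hs, div_self hvT0.ne', one_mul]; exact hx.le
    · rw [hs]; exact div_le_one_of_le₀ hxT hvT0.le
  · have hx0 : 0 < v x := zero_lt_one.trans_le hx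
    have hlt : v T < v (x ^ 2) := by
      rw [map_pow]; exact hT1.trans_le (one_le_pow₀ hx)
    have hs : v (x ^ 2 + T) = v x ^ 2 := by
      rw [Valuation.map_add_eq_of_lt_left _ hlt, map_pow]
    have h2 : 0 < v x ^ 2 := pow_pos hx0 2
    refine ⟨fun h => ?_, ?_, ?_, ?_⟩
    · rw [h, map_zero] at hs; exact h2.ne hs
    · rw [hs]; exact div_le_one_of_le₀ (hT1.le.trans (one_le_pow₀ hx)) h2.le
    · rw [hs, div_mul_eq_mul_div, div_le_one₀ h2, pow_two]
      exact mul_le_mul_left (hT1.le.trans hx) _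
    · rw [hs, div_le_one₀ h2, pow_two]
      exact le_mul_of_one_le_left' hx
end
section
variable {F : Type*} [Field F] {Γ : Type*} [LinearOrderedCommGroupWithZero Γ]

/-- A dominant term determines the valuation of a polynomial value. -/
lemma val_dom (v : Valuation F Γ) (g : F[X]) (x : F) (e : ℕ) (he : g.coeff e ≠ 0)
    (h : ∀ i, i ≠ e → g.coeff i ≠ 0 → v (g.coeff i) * v x ^ i < v (g.coeff e) * v x ^ e) :
    v (g.eval x) = v (g.coeff e) * v x ^ e := by
  classical
  rw [eval_eq_sum, Polynomial.sum,
    Valuation.map_sum_eq_of_lt v (j := e) (mem_support_iff.2 he)]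
  · simp
  · intro i hi
    simp only [Finset.mem_sdiff, Finset.mem_singleton, mem_support_iff] at hi
    simpa using h i hi.2 hi.1
end

section
variable {K : Type*} [Field K]

lemma HasVal.evalPoly {V : ValuationSubring K} {c y : K} {x : RatFunc K} (h : HasVal c x y)
    (g : (↥V)[X]) :
    HasVal c ((g.map (RatFunc.C.comp V.subtype)).eval x) ((g.map V.subtype).eval y) := by
  have hpow : ∀ n : ℕ, HasVal c (x ^ n) (y ^ n) := by
    intro n
    induction n with
    | zero => simpa using HasVal.const c (1 : K)
    | succ n ih => rw [pow_succ, pow_succ]; exact ih.mul h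
  induction g using Polynomial.induction_on' with
  | add p q hp hq => simpa using hp.add hq
  | monomial n a => simpa using (HasVal.const c (a : K)).mul (hpow n)

lemma evalPoly_coe {V : ValuationSubring K} (g : (↥V)[X]) (y : V) :
    (g.map V.subtype).eval (y : K) = ((g.eval y : V) : K) := by
  have := Polynomial.eval_map_apply V.subtype y (p := g)
  simpa using this

lemma residue_ne_zero_iff {V : ValuationSubring K} (z : V) :
    IsLocalRing.residue V z ≠ 0 ↔ V.valuation (z : K) = 1 := by
  rw [IsLocalRing.residue_ne_zero_iff_isUnit, V.valuation_eq_one_iff]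

/-- Residue field not algebraically closed. -/
lemma prufer_not_algClosed (V : ValuationSubring K)
    (hk : ¬ IsAlgClosed (IsLocalRing.ResidueField ↥V)) :
    IsPruferSet (RatFunc K) (IntRSub V : Set (RatFunc K)) := by
  obtain ⟨p, hpm, hpi, hpr⟩ : ∃ p : (IsLocalRing.ResidueField ↥V)[X], p.Monic ∧ Irreducible p ∧
      ∀ x, p.eval x ≠ 0 := by
    by_contra hcon
    push Not at hcon
    exact hk (IsAlgClosed.of_exists_root _ hcon)
  obtain ⟨f, hfp, hfd, hfm⟩ := lifts_and_degree_eq_and_monic (f := IsLocalRing.residue V)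
    (p := p) (by
      rw [lifts_iff_coeff_lifts]
      intro n
      exact IsLocalRing.residue_surjective _) hpm
  have hn : 1 ≤ f.natDegree := by
    rw [natDegree_eq_of_degree_eq hfd]
    exact hpi.natDegree_pos
  have hunit : ∀ y : V, V.valuation ((f.eval y : V) : K) = 1 := by
    intro y
    rw [← residue_ne_zero_iff]
    have := hpr (IsLocalRing.residue V y)
    rwa [← hfp, Polynomial.eval_map_apply] at this
  apply isPruferSet_of_pairs
  intro x
  set f' := f.map (RatFunc.C.comp V.subtype) with hf'
  have hf'm : f'.Monic := hfm.map _
  have hf'n : f'.natDegree = f.natDegree := hfm.natDegree_map _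
  have hdiv : f'.divX.eval x * x + f'.coeff 0 = f'.eval x := by
    conv_rhs => rw [← divX_mul_X_add f']
    simp
  have hdivX : f'.divX = f.divX.map (RatFunc.C.comp V.subtype) := by
    ext i; simp [hf', coeff_divX]
  suffices H : ∀ c ∈ V, f'.eval x ≠ 0 ∧ f'.coeff 0 / f'.eval x ∈ Wring V c ∧
      f'.coeff 0 / f'.eval x * x ∈ Wring V c ∧ f'.divX.eval x / f'.eval x ∈ Wring V c by
    have hne := (H 0 V.zero_mem).1
    have hs : f'.divX.eval x / f'.eval x * x + f'.coeff 0 / f'.eval x = 1 := by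
      rw [div_mul_eq_mul_div, ← add_div, hdiv, div_self hne]
    have hw : f'.coeff 0 / f'.eval x ∈ IntRSub V := mem_IntRSub.2 fun c hc => (H c hc).2.1
    refine ⟨_, _, mem_IntRSub.2 fun c hc => (H c hc).2.2.2, hw,
      ?_, mem_IntRSub.2 fun c hc => (H c hc).2.2.1, hs⟩
    rw [eq_sub_of_add_eq hs]
    exact (IntRSub V).sub_mem (IntRSub V).one_mem hw
  intro c hc
  have hcoef : ∀ i, f'.coeff i ∈ Wring V c := fun i =>
    ⟨(f.coeff i : K), (f.coeff i).2, by simpa [hf'] using HasVal.const c (f.coeff i : K)⟩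
  by_cases hx : x ∈ Wring V c
  · obtain ⟨y, hy, hxy⟩ := id hx
    have h1 := hxy.evalPoly f
    rw [← hf', evalPoly_coe f ⟨y, hy⟩] at h1
    have hu := hunit ⟨y, hy⟩
    have hne : ((f.eval ⟨y, hy⟩ : V) : K) ≠ 0 := by
      intro h0; rw [h0, map_zero] at hu; exact zero_ne_one hu
    have hinv : (f'.eval x)⁻¹ ∈ Wring V c := by
      refine inv_mem_Wring h1 hne ?_
      rw [← V.valuation_le_one_iff, map_inv₀, hu, inv_one]
    have hdm : f'.divX.eval x ∈ Wring V c := by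
      rw [hdivX]
      refine ⟨_, ?_, hxy.evalPoly f.divX⟩
      rw [evalPoly_coe f.divX ⟨y, hy⟩]
      exact (f.divX.eval ⟨y, hy⟩ : V).2
    refine ⟨?_, ?_, ?_, ?_⟩
    · intro h0
      have := h1.inv hne
      rw [h0] at h1
      have h2 := h1.unique (by simpa using HasVal.const c (0 : K))
      exact hne h2
    · rw [div_eq_mul_inv]; exact (Wring V c).mul_mem _ _ (hcoef 0) hinv
    · rw [div_eq_mul_inv]
      exact (Wring V c).mul_mem _ _ ((Wring V c).mul_mem _ _ (hcoef 0) hinv) hx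
    · rw [div_eq_mul_inv]; exact (Wring V c).mul_mem _ _ hdm hinv
  · set W := Wring V c with hW
    set v := W.valuation with hv
    have hx1 : 1 < v x := by
      rw [← not_le]; exact fun h => hx ((W.valuation_le_one_iff _).1 h)
    have hx0 : 0 < v x := zero_lt_one.trans hx1
    have hval : v (f'.eval x) = v x ^ f.natDegree := by
      have hlead : f'.coeff f.natDegree = 1 := by rw [← hf'n]; exact hf'm
      rw [val_dom v f' x f.natDegree (by rw [hlead]; exact one_ne_zero), hlead, map_one, one_mul]
      intro i hi hci
      rw [hlead, map_one, one_mul]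
      have hlt : i < f.natDegree :=
        lt_of_le_of_ne (hf'n ▸ le_natDegree_of_ne_zero hci) hi
      calc v (f'.coeff i) * v x ^ i ≤ 1 * v x ^ i :=
            mul_le_mul_left ((W.valuation_le_one_iff _).2 (hcoef i)) _
        _ = v x ^ i := one_mul _
        _ < _ := pow_lt_pow_right₀ hx1 hlt
    have hpos : 0 < v x ^ f.natDegree := pow_pos hx0 _
    have hne : f'.eval x ≠ 0 := by
      intro h0; rw [h0, map_zero] at hval; exact hpos.ne hval
    have hc0 : v (f'.coeff 0) ≤ 1 := (W.valuation_le_one_iff _).2 (hcoef 0)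
    have hwx : v (f'.coeff 0 / f'.eval x * x) ≤ 1 := by
      rw [map_mul, map_div₀, hval, div_mul_eq_mul_div, div_le_one₀ hpos]
      calc v (f'.coeff 0) * v x ≤ 1 * v x := mul_le_mul_left hc0 _
        _ = v x ^ 1 := by rw [one_mul, pow_one]
        _ ≤ _ := pow_le_pow_right₀ hx1.le hn
    have hw : v (f'.coeff 0 / f'.eval x) ≤ 1 := by
      rw [map_div₀, hval, div_le_one₀ hpos]
      exact hc0.trans (one_le_pow₀ hx1.le)
    have hu : v (f'.divX.eval x / f'.eval x) ≤ 1 := by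
      have hs : f'.divX.eval x / f'.eval x * x = 1 - f'.coeff 0 / f'.eval x := by
        rw [eq_sub_iff_add_eq, div_mul_eq_mul_div, ← add_div, hdiv, div_self hne]
      have h1 : v (f'.divX.eval x / f'.eval x * x) ≤ 1 := by
        rw [hs]
        exact (v.map_sub _ _).trans (max_le (by rw [map_one]) hw)
      rw [map_mul] at h1
      exact (le_mul_of_one_le_right' hx1.le).trans h1
    exact ⟨hne, (W.valuation_le_one_iff _).1 hw, (W.valuation_le_one_iff _).1 hwx,
      (W.valuation_le_one_iff _).1 hu⟩

/-- `P d` holds for all `d` in the maximal ideal with valuation sufficiently close to `1`. -/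
def Ev (V : ValuationSubring K) (P : K → Prop) : Prop :=
  ∃ r < (1 : V.ValueGroup), ∀ d, r < V.valuation d → V.valuation d < 1 → P d

/-- There is no largest value below `1`. -/
def Dense1 (V : ValuationSubring K) : Prop :=
  ∀ r < (1 : V.ValueGroup), ∃ d, r < V.valuation d ∧ V.valuation d < 1

variable {V : ValuationSubring K}

lemma Ev.and {P Q : K → Prop} (hP : Ev V P) (hQ : Ev V Q) : Ev V (fun d => P d ∧ Q d) := by
  obtain ⟨r, hr, h⟩ := hP
  obtain ⟨s, hs, h'⟩ := hQ
  exact ⟨max r s, max_lt hr hs, fun d hd hd1 =>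
    ⟨h d ((le_max_left _ _).trans_lt hd) hd1, h' d ((le_max_right _ _).trans_lt hd) hd1⟩⟩

lemma Ev.mono {P Q : K → Prop} (hP : Ev V P)
    (h : ∀ d, 0 < V.valuation d → V.valuation d < 1 → P d → Q d) : Ev V Q := by
  obtain ⟨r, hr, h1⟩ := hP
  exact ⟨r, hr, fun d hd hd1 => h d (zero_le.trans_lt hd) hd1 (h1 d hd hd1)⟩

lemma Ev.of_all {P : K → Prop} (h : ∀ d, 0 < V.valuation d → V.valuation d < 1 → P d) :
    Ev V P := ⟨0, zero_lt_one, h⟩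

lemma Ev.exists (hV : Dense1 V) {P : K → Prop} (hP : Ev V P) :
    ∃ d, 0 < V.valuation d ∧ V.valuation d < 1 ∧ P d := by
  obtain ⟨r, hr, h1⟩ := hP
  obtain ⟨d, hd, hd1⟩ := hV r hr
  exact ⟨d, zero_le.trans_lt hd, hd1, h1 d hd hd1⟩

lemma Ev.forall_lt {P : ℕ → K → Prop} (N : ℕ) (h : ∀ i < N, Ev V (P i)) :
    Ev V (fun d => ∀ i < N, P i d) := by
  induction N with
  | zero => exact Ev.of_all (by simp)
  | succ N ih =>
    refine ((ih fun i hi => h i (by omega)).and (h N (by omega))).mono ?_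
    rintro d - - ⟨h1, h2⟩ i hi
    rcases Nat.lt_succ_iff_lt_or_eq.1 hi with h | rfl
    · exact h1 i h
    · exact h2

lemma Ev.lt_pow (hV : Dense1 V) (N : ℕ) : ∀ s < (1 : V.ValueGroup),
    Ev V (fun d => s < V.valuation d ^ N) := by
  induction N with
  | zero => intro s hs; exact Ev.of_all (by simpa using fun _ _ _ => hs)
  | succ N ih =>
    intro s hs
    obtain ⟨d0, h0, h1⟩ := hV s hs
    have hd0 : 0 < V.valuation d0 := zero_le.trans_lt h0
    have e1 := ih (s / V.valuation d0) ((div_lt_one₀ hd0).2 h0)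
    have e2 : Ev V (fun d => V.valuation d0 < V.valuation d) := ⟨_, h1, fun d hd _ => hd⟩
    refine (e1.and e2).mono ?_
    rintro d hd - ⟨ha, hb⟩
    rw [div_lt_iff₀ hd0] at ha
    rw [pow_succ]
    refine ha.trans ?_
    have : 0 < V.valuation d ^ N := pow_pos hd N
    gcongr

lemma Ev.comp_sq (hV : Dense1 V) {P : K → Prop} (hP : Ev V P) : Ev V (fun d => P (d ^ 2)) := by
  obtain ⟨r, hr, h1⟩ := hP
  refine (Ev.lt_pow hV 2 r hr).mono ?_
  intro d hd hd1 h
  refine h1 _ (by rwa [map_pow]) ?_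
  rw [map_pow]
  exact pow_lt_one₀ zero_le hd1 two_ne_zero

lemma coeff_le_one (g : (↥V)[X]) (i : ℕ) :
    V.valuation ((g.map V.subtype).coeff i) ≤ 1 := by
  rw [coeff_map]; exact V.valuation_le_one _

lemma coeff_eq_one (g : (↥V)[X]) (i : ℕ) (h : (g.map (IsLocalRing.residue V)).coeff i ≠ 0) :
    V.valuation ((g.map V.subtype).coeff i) = 1 := by
  rw [coeff_map] at *
  exact (residue_ne_zero_iff _).1 h

lemma coeff_lt_one (g : (↥V)[X]) (i : ℕ) (h : (g.map (IsLocalRing.residue V)).coeff i = 0) :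
    V.valuation ((g.map V.subtype).coeff i) < 1 := by
  refine lt_of_le_of_ne (coeff_le_one g i) fun h1 => ?_
  rw [coeff_map] at *
  exact (residue_ne_zero_iff _).2 h1 h

lemma Ev.zero_val (hV : Dense1 V) (g : (↥V)[X]) (hg : g.map (IsLocalRing.residue V) ≠ 0) :
    Ev V (fun d => V.valuation ((g.map V.subtype).eval d) =
      V.valuation d ^ (g.map (IsLocalRing.residue V)).natTrailingDegree) := by
  set e := (g.map (IsLocalRing.residue V)).natTrailingDegree with he
  have h1 := coeff_eq_one g e (by
    rw [he]; exact mt trailingCoeff_eq_zero.1 hg)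
  have hne : (g.map V.subtype).coeff e ≠ 0 := by
    intro h0; rw [h0, map_zero] at h1; exact zero_ne_one h1
  have hE : Ev V (fun d => ∀ i < e, V.valuation ((g.map V.subtype).coeff i) < V.valuation d ^ e) := by
    refine Ev.forall_lt e fun i hi => Ev.lt_pow hV e _ (coeff_lt_one g i ?_)
    exact coeff_eq_zero_of_lt_natTrailingDegree hi
  refine hE.mono ?_
  intro d hd hd1 h
  rw [val_dom V.valuation (g.map V.subtype) d e hne, h1, one_mul]
  intro i hi _
  rw [h1, one_mul]
  rcases lt_or_gt_of_ne hi with hlt | hgt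
  · refine lt_of_le_of_lt ?_ (h i hlt)
    exact mul_le_of_le_one_right' (pow_le_one₀ zero_le hd1.le)
  · calc _ ≤ 1 * V.valuation d ^ i := mul_le_mul_left (coeff_le_one g i) _
      _ = V.valuation d ^ i := one_mul _
      _ < _ := pow_lt_pow_right_of_lt_one₀ hd hd1 hgt

lemma Ev.infty_val (hV : Dense1 V) (g : (↥V)[X]) (hg : g.map (IsLocalRing.residue V) ≠ 0) :
    Ev V (fun d => V.valuation ((g.map V.subtype).eval d⁻¹) =
      (V.valuation d)⁻¹ ^ (g.map (IsLocalRing.residue V)).natDegree) := by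
  set e := (g.map (IsLocalRing.residue V)).natDegree with he
  have h1 := coeff_eq_one g e (by
    rw [he]; exact mt leadingCoeff_eq_zero.1 hg)
  have hne : (g.map V.subtype).coeff e ≠ 0 := by
    intro h0; rw [h0, map_zero] at h1; exact zero_ne_one h1
  have hE : Ev V (fun d => ∀ i < g.natDegree + 1, e < i →
      V.valuation ((g.map V.subtype).coeff i) < V.valuation d ^ i) := by
    refine Ev.forall_lt _ fun i hi => ?_
    by_cases hei : e < i
    · refine (Ev.lt_pow hV i _ (coeff_lt_one g i ?_)).mono fun d _ _ h _ => h
      exact coeff_eq_zero_of_natDegree_lt hei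
    · exact Ev.of_all fun _ _ _ h => absurd h hei
  refine hE.mono ?_
  intro d hd hd1 h
  have hq : 1 < (V.valuation d)⁻¹ := (one_lt_inv₀ hd).2 hd1
  rw [val_dom V.valuation (g.map V.subtype) d⁻¹ e hne, h1, one_mul, map_inv₀]
  intro i hi hci
  rw [h1, one_mul, map_inv₀]
  rcases lt_or_gt_of_ne hi with hlt | hgt
  · calc _ ≤ 1 * (V.valuation d)⁻¹ ^ i := mul_le_mul_left (coeff_le_one g i) _
      _ = (V.valuation d)⁻¹ ^ i := one_mul _
      _ < _ := pow_lt_pow_right₀ hq hlt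
  · have hin : i < g.natDegree + 1 :=
      Nat.lt_succ_iff.2 ((le_natDegree_of_ne_zero hci).trans natDegree_map_le)
    have := h i hin hgt
    refine lt_of_lt_of_le ?_ (one_le_pow₀ hq.le)
    rw [inv_pow, ← div_eq_mul_inv]
    exact (div_lt_one₀ (pow_pos hd i)).2 this

lemma exists_scale (h : K[X]) (hh : h ≠ 0) : ∃ l : K, l ≠ 0 ∧ ∃ g : (↥V)[X],
    h = C l * g.map V.subtype ∧ g.map (IsLocalRing.residue V) ≠ 0 := by
  obtain ⟨i, hi, hmax⟩ := h.support.exists_max_image (fun i => V.valuation (h.coeff i))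
    (nonempty_support_iff.2 hh)
  have hl : h.coeff i ≠ 0 := mem_support_iff.1 hi
  have hlift : C (h.coeff i)⁻¹ * h ∈ lifts V.subtype := by
    rw [lifts_iff_coeff_lifts]
    intro j
    have : (C (h.coeff i)⁻¹ * h).coeff j ∈ V := by
      rw [coeff_C_mul, ← V.valuation_le_one_iff, map_mul, map_inv₀]
      by_cases hj : h.coeff j = 0
      · simp [hj]
      · have := hmax j (mem_support_iff.2 hj)
        rw [mul_comm, ← div_eq_mul_inv]
        exact div_le_one_of_le₀ this zero_le
    exact ⟨⟨_, this⟩, rfl⟩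
  obtain ⟨g, hg⟩ := (mem_lifts _).1 hlift
  refine ⟨h.coeff i, hl, g, ?_, ?_⟩
  · rw [hg, ← mul_assoc, ← C_mul, mul_inv_cancel₀ hl, C_1, one_mul]
  · intro h0
    have h1 := coeff_lt_one g i (by rw [h0, coeff_zero])
    rw [hg, coeff_C_mul, inv_mul_cancel₀ hl, map_one] at h1
    exact lt_irrefl _ h1

lemma core_s13 [IsAlgClosed (IsLocalRing.ResidueField ↥V)] (hV : Dense1 V) (f g : (↥V)[X])
    (hf : f.map (IsLocalRing.residue V) ≠ 0) (hg : g.map (IsLocalRing.residue V) ≠ 0)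
    (l : K)
    (h0 : ∀ y ∈ V, V.valuation l * V.valuation ((f.map V.subtype).eval y) ≤
      V.valuation ((g.map V.subtype).eval y))
    (h1 : ∀ d, 0 < V.valuation d → V.valuation d < 1 →
      V.valuation l * V.valuation ((f.map V.subtype).eval d) <
      V.valuation ((g.map V.subtype).eval d))
    (hinf : Ev V (fun d => V.valuation l * V.valuation ((f.map V.subtype).eval d⁻¹) =
      V.valuation ((g.map V.subtype).eval d⁻¹))) : False := by
  set f' := f.map (IsLocalRing.residue V) with hf'
  set g' := g.map (IsLocalRing.residue V) with hg'
  have E : Ev V (fun d => V.valuation l * (V.valuation d)⁻¹ ^ f'.natDegree =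
      (V.valuation d)⁻¹ ^ g'.natDegree) := by
    refine ((hinf.and (Ev.infty_val hV f hf)).and (Ev.infty_val hV g hg)).mono ?_
    rintro d - - ⟨⟨ha, hb⟩, hc⟩
    rwa [hb, hc] at ha
  obtain ⟨hdeg, hl⟩ : f'.natDegree = g'.natDegree ∧ V.valuation l = 1 := by
    obtain ⟨d, hd, hd1, ha, hb⟩ := (E.and (E.comp_sq hV)).exists hV
    have hq : 1 < (V.valuation d)⁻¹ := (one_lt_inv₀ hd).2 hd1
    rw [map_pow] at hb
    set q := (V.valuation d)⁻¹ with hqdef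
    have hq0 : q ≠ 0 := (zero_lt_one.trans hq).ne'
    have hb' : V.valuation l * q ^ f'.natDegree * q ^ f'.natDegree
        = q ^ g'.natDegree * q ^ g'.natDegree := by
      rw [← inv_pow, ← hqdef, ← pow_mul, ← pow_mul] at hb
      rw [mul_assoc, ← pow_add, ← pow_add, ← two_mul, ← two_mul]
      exact hb
    rw [ha] at hb'
    have hc := mul_left_cancel₀ (pow_ne_zero _ hq0) hb'
    have hdeg := pow_right_injective₀ (zero_lt_one.trans hq) hq.ne' hc
    refine ⟨hdeg, ?_⟩
    rw [hdeg] at ha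
    exact mul_right_cancel₀ (pow_ne_zero _ hq0) (ha.trans (one_mul _).symm)
  rw [hl] at h0 h1
  simp only [one_mul] at h0 h1
  have hmult : ∀ a : V, g'.rootMultiplicity (IsLocalRing.residue V a) ≤
      f'.rootMultiplicity (IsLocalRing.residue V a) := by
    intro a
    have hcomp : ∀ p : (↥V)[X], (p.comp (X + C a)).map (IsLocalRing.residue V) =
        (p.map (IsLocalRing.residue V)).comp (X + C (IsLocalRing.residue V a)) := by
      intro p; simp [Polynomial.map_comp]
    have hcomp0 : ∀ p : (↥V)[X], p.map (IsLocalRing.residue V) ≠ 0 →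
        (p.comp (X + C a)).map (IsLocalRing.residue V) ≠ 0 := by
      intro p hp h
      rw [hcomp, comp_X_add_C_eq_zero_iff] at h
      exact hp h
    have ev : ∀ (p : (↥V)[X]) (d : K), ((p.comp (X + C a)).map V.subtype).eval d =
        (p.map V.subtype).eval (d + a) := by
      intro p d; simp [Polynomial.map_comp]
    obtain ⟨d, hd, hd1, ha, hb⟩ := ((Ev.zero_val hV _ (hcomp0 f hf)).and
      (Ev.zero_val hV _ (hcomp0 g hg))).exists hV
    rw [ev, hcomp, ← rootMultiplicity_eq_natTrailingDegree] at ha hb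
    have := h0 (d + a) (V.add_mem _ _ ((V.valuation_le_one_iff _).1 hd1.le) a.2)
    rw [ha, hb] at this
    by_contra hcon
    exact absurd this (not_le.2 (pow_lt_pow_right_of_lt_one₀ hd hd1 (not_le.1 hcon)))
  have hmult0 : g'.rootMultiplicity 0 < f'.rootMultiplicity 0 := by
    rw [rootMultiplicity_eq_natTrailingDegree', rootMultiplicity_eq_natTrailingDegree']
    obtain ⟨d, hd, hd1, ha, hb⟩ := ((Ev.zero_val hV f hf).and
      (Ev.zero_val hV g hg)).exists hV
    have := h1 d hd hd1
    rw [ha, hb] at this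
    by_contra hcon
    exact absurd this (not_lt.2 (pow_le_pow_right_of_le_one' hd1.le (not_lt.1 hcon)))
  classical
  have hle : g'.roots ≤ f'.roots := by
    rw [Multiset.le_iff_count]
    intro a
    obtain ⟨a, rfl⟩ := IsLocalRing.residue_surjective a
    rw [count_roots, count_roots]
    exact hmult a
  have hcard : ∀ p : (IsLocalRing.ResidueField ↥V)[X], p.roots.card = p.natDegree := fun p =>
    splits_iff_card_roots.1 (IsAlgClosed.splits p)
  have heq := Multiset.eq_of_le_of_card_le hle (by rw [hcard, hcard, hdeg])
  rw [← count_roots, ← count_roots, heq] at hmult0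
  exact lt_irrefl _ hmult0

lemma dense1_of_not_principal (h : ¬ (IsLocalRing.maximalIdeal ↥V).IsPrincipal) : Dense1 V := by
  intro r hr
  by_contra hcon
  push Not at hcon
  obtain ⟨ρ, rfl⟩ := V.valuation_surjective r
  have hρ : ρ ∈ V := (V.valuation_le_one_iff _).1 hr.le
  apply h
  refine ⟨⟨⟨ρ, hρ⟩, le_antisymm ?_ ?_⟩⟩
  · intro z hz
    rw [V.valuation_lt_one_iff] at hz
    have hle : V.valuation (z : K) ≤ V.valuation ρ := by
      by_contra hlt
      exact absurd hz (not_lt.2 (hcon z (not_le.1 hlt)))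
    obtain ⟨a, ha⟩ := (V.valuation_le_iff _ _).1 hle
    exact Ideal.mem_span_singleton'.2 ⟨a, Subtype.ext ha⟩
  · rw [Ideal.submodule_span_eq, Ideal.span_le, Set.singleton_subset_iff]
    exact (V.valuation_lt_one_iff ⟨ρ, hρ⟩).2 hr

lemma not_prufer [IsAlgClosed (IsLocalRing.ResidueField ↥V)]
    (hm : ¬ (IsLocalRing.maximalIdeal ↥V).IsPrincipal)
    (hP : IsPruferSet (RatFunc K) {φ | IntegerValued V φ}) : False := by
  have hV := dense1_of_not_principal hm
  obtain ⟨t, ht, ht1⟩ := hV 0 zero_lt_one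
  have ht0 : t ≠ 0 := by rintro rfl; simp at ht
  have htV : t ∈ V := (V.valuation_le_one_iff _).1 ht1.le
  obtain ⟨b, hb, hs⟩ := hP 2 ![RatFunc.C t, RatFunc.X] (by
    intro i
    simp only [Set.mem_ofPred_eq, integerValued_iff]
    intro c hc
    fin_cases i
    · exact ⟨t, htV, HasVal.const c t⟩
    · exact ⟨c, hc, by simpa using HasVal.poly c X⟩) ⟨0, by simpa using ht0⟩
  simp only [Set.mem_ofPred_eq, integerValued_iff] at hb
  rw [Fin.sum_univ_two] at hs
  have h00 := hb 0 0
  have h01 := hb 0 1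
  have h10 := hb 1 0
  have h11 := hb 1 1
  simp only [Matrix.cons_val_zero, Matrix.cons_val_one] at hs h00 h01 h10 h11
  set p := b 1 * RatFunc.X with hp
  have hXv : ∀ c : K, HasVal c (RatFunc.X) c := fun c => by simpa using HasVal.poly c X
  have hpV : ∀ c ∈ V, ∃ y, V.valuation y ≤ 1 ∧ HasVal c p y := by
    intro c hc
    obtain ⟨y, hy, h⟩ := h11 c hc
    exact ⟨y, (V.valuation_le_one_iff _).2 hy, h⟩
  have hp0 : ∀ d, 0 < V.valuation d → V.valuation d < 1 →
      ∃ y, V.valuation y < 1 ∧ HasVal (t * d) p y := by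
    intro d hd hd1
    have hc : t * d ∈ V := V.mul_mem _ _ htV ((V.valuation_le_one_iff _).1 hd1.le)
    obtain ⟨y, hy, h⟩ := h11 _ hc
    obtain ⟨z, hz, h'⟩ := h10 _ hc
    have e1 := h.mul (HasVal.const (t * d) t)
    have e2 := h'.mul (hXv (t * d))
    have : y * t = z * (t * d) := by
      refine e1.unique ?_
      convert e2 using 1
      rw [hp]; ring
    have hyz : y = z * d := mul_right_cancel₀ ht0 (by rw [this]; ring)
    refine ⟨y, ?_, h⟩
    rw [hyz, map_mul]
    exact mul_lt_of_le_one_of_lt ((V.valuation_le_one_iff _).2 hz) hd1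
  have hpinf : ∀ d, V.valuation t < V.valuation d → V.valuation d < 1 →
      ∃ y, V.valuation y = 1 ∧ HasVal (t * d⁻¹) p y := by
    intro d hd hd1
    have hd0 : 0 < V.valuation d := zero_le.trans_lt hd
    have hdne : d ≠ 0 := by rintro rfl; simp at hd0
    have hc : t * d⁻¹ ∈ V := by
      rw [← V.valuation_le_one_iff, map_mul, map_inv₀, ← div_eq_mul_inv]
      exact div_le_one_of_le₀ hd.le zero_le
    obtain ⟨y, hy, h⟩ := h11 _ hc
    obtain ⟨q, hq, hq'⟩ := h00 _ hc
    obtain ⟨z, hz, h'⟩ := h01 _ hc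
    have e1 := hq'.mul (hXv (t * d⁻¹))
    have e2 := h'.mul (HasVal.const (t * d⁻¹) t)
    have e3 : q * (t * d⁻¹) = z * t := by
      refine e1.unique ?_
      convert e2 using 1
      ring
    have hqz : q = z * d := by field_simp at e3; exact e3.trans (mul_comm _ _)
    have e4 := hq'.add h
    rw [hs] at e4
    have e5 : q + y = 1 := e4.unique (by simpa using HasVal.const (t * d⁻¹) (1 : K))
    refine ⟨y, ?_, h⟩
    have hq1 : V.valuation q < 1 := by
      rw [hqz, map_mul]
      exact mul_lt_of_le_one_of_lt ((V.valuation_le_one_iff _).2 hz) hd1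
    rw [eq_sub_of_add_eq' e5]
    exact Valuation.map_one_sub_of_lt _ hq1
  have hpne : p ≠ 0 := by
    intro h0
    obtain ⟨d, hd, hd1⟩ := hV _ ht1
    obtain ⟨y, hy, h⟩ := hpinf d hd hd1
    rw [h0] at h
    have := h.unique (by simpa using HasVal.const (t * d⁻¹) (0 : K))
    rw [this, map_zero] at hy
    exact zero_ne_one hy
  have hcomp : ∀ h : K[X], h ≠ 0 → h.comp (C t * X) ≠ 0 := by
    intro h hh h0
    rw [comp_C_mul_X_eq_zero_iff (mem_nonZeroDivisors_of_ne_zero ht0)] at h0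
    exact hh h0
  obtain ⟨l1, hl1, f, hf, hf'⟩ := exists_scale (V := V) _ (hcomp _ (RatFunc.num_ne_zero hpne))
  obtain ⟨l2, hl2, g, hg, hg'⟩ := exists_scale (V := V) _ (hcomp _ (RatFunc.denom_ne_zero p))
  have key : ∀ s y, HasVal (t * s) p y → (f.map V.subtype).eval s * l1 =
      y * ((g.map V.subtype).eval s * l2) ∧ (g.map V.subtype).eval s ≠ 0 := by
    rintro s y ⟨ha, hb⟩
    have e1 := congrArg (eval s) hf
    have e2 := congrArg (eval s) hg
    simp only [eval_comp, eval_mul, eval_C, eval_X] at e1 e2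
    rw [e2] at ha
    rw [e1, e2, div_eq_iff ha] at hb
    exact ⟨by rw [mul_comm, hb]; ring, right_ne_zero_of_mul ha⟩
  have key2 : ∀ s y, HasVal (t * s) p y →
      V.valuation (l1 / l2) * V.valuation ((f.map V.subtype).eval s) =
      V.valuation y * V.valuation ((g.map V.subtype).eval s) := by
    intro s y h
    rw [← map_mul, ← map_mul]
    congr 1
    have := (key s y h).1
    field_simp
    rw [mul_comm l1, this]; ring
  refine core_s13 hV f g hf' hg' (l1 / l2) ?_ ?_ ?_
  · intro y hy
    obtain ⟨z, hz, h⟩ := hpV _ (V.mul_mem _ _ htV hy)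
    rw [key2 _ _ h]
    exact mul_le_of_le_one_left' hz
  · intro d hd hd1
    obtain ⟨z, hz, h⟩ := hp0 d hd hd1
    rw [key2 _ _ h]
    have : 0 < V.valuation ((g.map V.subtype).eval d) :=
      zero_lt_iff.2 (by simpa using (key _ _ h).2)
    exact mul_lt_of_lt_one_left this hz
  · refine ⟨V.valuation t, ht1, fun d hd hd1 => ?_⟩
    obtain ⟨z, hz, h⟩ := hpinf d hd hd1
    rw [key2 _ _ h, hz, one_mul]
end

theorem statement13 (K : Type*) [Field K] (V : ValuationSubring K) :
    IsPruferSet (RatFunc K) {φ | IntegerValued V φ} ↔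
      (¬ IsAlgClosed (IsLocalRing.ResidueField ↥V) ∨
        (IsLocalRing.maximalIdeal ↥V).IsPrincipal) := by
  constructor
  · intro h
    by_contra hcon
    push Not at hcon
    obtain ⟨h1, h2⟩ := hcon
    exact not_prufer h2 h
  · rintro (h | ⟨⟨t, ht⟩⟩)
    · exact prufer_not_algClosed V h
    · have hmem : ∀ z : V, V.valuation (z : K) < 1 ↔ ∃ a : V, a * t = z := by
        intro z
        rw [← V.valuation_lt_one_iff, ht, Ideal.submodule_span_eq, Ideal.mem_span_singleton']
      by_cases ht0 : (t : K) = 0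
      · have hz : ∀ z ∈ V, z⁻¹ ∈ V := by
          intro z hz
          rcases V.valuation_lt_one_or_eq_one ⟨z, hz⟩ with h | h
          · obtain ⟨a, ha⟩ := (hmem _).1 h
            have := congrArg (fun x : V => (x : K)) ha
            simp only [MulMemClass.coe_mul, ht0, mul_zero] at this
            rw [← this, inv_zero]; exact V.zero_mem
          · rw [← V.valuation_le_one_iff, map_inv₀, h, inv_one]
        refine prufer_top V fun x => ?_
        rcases V.mem_or_inv_mem x with h | h
        · exact h
        · simpa using hz _ h
      · have ht1 : V.valuation (t : K) < 1 := (hmem t).2 ⟨1, one_mul t⟩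
        refine prufer_principal V t ht0 t.2 ?_ ?_
        · intro h
          rw [← V.valuation_le_one_iff, map_inv₀] at h
          exact absurd h (not_le.2 ((one_lt_inv₀ (zero_lt_iff.2 (by simpa using ht0))).2 ht1))
        · intro z hz hzi
          have hz1 : V.valuation z < 1 := by
            rcases V.valuation_lt_one_or_eq_one ⟨z, hz⟩ with h | h
            · exact h
            · refine absurd ?_ hzi
              rw [← V.valuation_le_one_iff, map_inv₀, h, inv_one]
          obtain ⟨a, ha⟩ := (hmem ⟨z, hz⟩).1 hz1
          have := congrArg (fun x : V => (x : K)) ha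
          simp only [MulMemClass.coe_mul] at this
          rw [← this, mul_div_cancel_right₀ _ ht0]
          exact a.2
end

section
/- Let V be a valuation domain with field of fractions K and maximal ideal 𝔪. Suppose 𝔪 is not a principal ideal of V and there do not exist two nonconstant polynomials over the residue field V/𝔪 of coprime degrees neither of which has a root in V/𝔪. Then IntR(V) is not a Bézout domain; indeed, for any nonzero t ∈ 𝔪, the finitely generated ideal (x, t) of IntR(V) is not principal. -/
open Polynomial

/-- A subring (given as a subset `R` of its fraction field `F`) is a Bézout domain:
every finitely generated ideal `(a₁, …, aₙ)` is principal, i.e. generated by a single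
element `g`. -/
def IsBezoutSet (F : Type*) [Field F] (R : Set F) : Prop :=
  ∀ (n : ℕ) (a : Fin n → F), (∀ i, a i ∈ R) →
    ∃ g ∈ R, (∀ i, ∃ r ∈ R, a i = g * r) ∧
      ∃ c : Fin n → F, (∀ i, c i ∈ R) ∧ g = ∑ i, c i * a i


section aux
open IsLocalRing
variable {V : Type*} [CommRing V] [IsDomain V] [ValuationRing V]

lemma aux_half (hnp : ¬ (maximalIdeal V).IsPrincipal) (d : V) (hd : d ∈ maximalIdeal V) :
    ∃ e ∈ maximalIdeal V, e ^ 2 ∣ d := by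
  have h1 : ¬ (maximalIdeal V ≤ Ideal.span {d}) := by
    intro h
    apply hnp
    exact ⟨d, le_antisymm h ((Ideal.span_singleton_le_iff_mem _).2 hd)⟩
  obtain ⟨f, hf, hfd⟩ := SetLike.not_le_iff_exists.1 h1
  rw [Ideal.mem_span_singleton] at hfd
  rcases ValuationRing.dvd_total f d with ⟨h, rfl⟩ | h
  · have hh : h ∈ maximalIdeal V := by
      rw [mem_maximalIdeal, mem_nonunits_iff]
      intro hu
      exact hfd (hu.mul_right_dvd.2 dvd_rfl)
    rcases ValuationRing.dvd_total f h with ⟨k, rfl⟩ | ⟨k, rfl⟩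
    · exact ⟨f, hf, k, by ring⟩
    · exact ⟨h, hh, k, by ring⟩
  · exact absurd h hfd

lemma aux_pow (hnp : ¬ (maximalIdeal V).IsPrincipal) (d : V) (hd : d ∈ maximalIdeal V) (N : ℕ) :
    ∃ e ∈ maximalIdeal V, e ^ N ∣ d := by
  have : ∀ n : ℕ, ∃ e ∈ maximalIdeal V, e ^ (2 ^ n) ∣ d := by
    intro n
    induction n with
    | zero => exact ⟨d, hd, by simp⟩
    | succ n ih =>
      obtain ⟨e, he, hed⟩ := ih
      obtain ⟨f, hf, hfe⟩ := aux_half hnp e he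
      refine ⟨f, hf, ?_⟩
      rw [pow_succ', pow_mul]
      exact (pow_dvd_pow_of_dvd hfe _).trans hed
  obtain ⟨e, he, hed⟩ := this N
  exact ⟨e, he, (pow_dvd_pow e Nat.lt_two_pow_self.le).trans hed⟩

/-- a common nonzero divisor in the maximal ideal -/
lemma aux_common (hnp : ¬ (maximalIdeal V).IsPrincipal) (s : Finset ℕ) (b : ℕ → V)
    (hb : ∀ i ∈ s, b i ∈ maximalIdeal V) :
    ∃ d ∈ maximalIdeal V, d ≠ 0 ∧ ∀ i ∈ s, d ∣ b i := by
  classical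
  induction s using Finset.induction_on with
  | empty =>
    have : maximalIdeal V ≠ ⊥ := by
      intro h
      apply hnp
      rw [h]
      exact ⟨0, Ideal.span_singleton_zero.symm⟩
    obtain ⟨d, hd, h0⟩ := Submodule.exists_mem_ne_zero_of_ne_bot this
    exact ⟨d, hd, h0, by simp⟩
  | insert a s ha ih =>
    obtain ⟨d, hd, h0, h⟩ := ih (fun i hi => hb i (Finset.mem_insert_of_mem hi))
    rcases ValuationRing.dvd_total d (b a) with h1 | h1
    · refine ⟨d, hd, h0, ?_⟩
      intro i hi
      rcases Finset.mem_insert.1 hi with rfl | hi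
      · exact h1
      · exact h i hi
    · refine ⟨b a, hb a (Finset.mem_insert_self _ _), ?_, ?_⟩
      · rintro h2
        rw [h2] at h1
        exact h0 (zero_dvd_iff.1 h1)
      intro i hi
      rcases Finset.mem_insert.1 hi with rfl | hi
      · exact dvd_rfl
      · exact h1.trans (h i hi)

lemma aux_C (hnp : ¬ (maximalIdeal V).IsPrincipal) (B : V[X]) (m : ℕ)
    (hm : IsUnit (B.coeff m)) (hlt : ∀ i < m, B.coeff i ∈ maximalIdeal V) :
    ∃ d ∈ maximalIdeal V, d ≠ 0 ∧ ∀ e ∈ maximalIdeal V, e ^ (m + 1) ∣ d →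
      ∃ u, IsUnit u ∧ B.eval e = e ^ m * u := by
  obtain ⟨d, hd, h0, hdv⟩ := aux_common hnp (Finset.range m) B.coeff
    (fun i hi => hlt i (Finset.mem_range.1 hi))
  refine ⟨d, hd, h0, fun e he hed => ?_⟩
  have key : ∀ i, ∃ c, B.coeff i * e ^ i = e ^ m * c ∧
      (i ≠ m → c ∈ maximalIdeal V) ∧ (i = m → c = B.coeff m) := by
    intro i
    rcases lt_trichotomy i m with h | h | h
    · obtain ⟨k, hk⟩ := hed.trans (hdv i (Finset.mem_range.2 h))
      refine ⟨e * (k * e ^ i), ?_, fun _ => Ideal.mul_mem_right _ _ he, fun h' => by omega⟩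
      rw [hk]; ring
    · subst h
      exact ⟨B.coeff i, by ring, fun h => absurd rfl h, fun _ => rfl⟩
    · obtain ⟨j, rfl⟩ := Nat.exists_eq_add_of_lt h
      refine ⟨e * (e ^ j * B.coeff (m + j + 1)), by ring,
        fun _ => Ideal.mul_mem_right _ _ he, fun h' => by omega⟩
  choose c hc1 hc2 hc3 using key
  have hmem : m ∈ B.support := by
    rw [mem_support_iff]; exact hm.ne_zero
  refine ⟨∑ i ∈ B.support, c i, ?_, ?_⟩
  · rw [← Finset.add_sum_erase _ _ hmem, hc3 m rfl]
    have : ∑ i ∈ B.support.erase m, c i ∈ maximalIdeal V :=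
      Ideal.sum_mem _ fun i hi => hc2 i (Finset.ne_of_mem_erase hi)
    by_contra hcon
    have h2 : B.coeff m ∈ maximalIdeal V :=
      (Ideal.add_mem_iff_left _ this).1 ((mem_maximalIdeal _).2 hcon)
    exact h2 hm
  · rw [eval_eq_sum, Polynomial.sum, Finset.mul_sum]
    exact Finset.sum_congr rfl fun i _ => hc1 i

/-- two polynomials at once, with a prescribed bound -/
lemma aux_D (hnp : ¬ (maximalIdeal V).IsPrincipal) (B B' : V[X]) (m m' : ℕ)
    (hm : IsUnit (B.coeff m)) (hlt : ∀ i < m, B.coeff i ∈ maximalIdeal V)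
    (hm' : IsUnit (B'.coeff m')) (hlt' : ∀ i < m', B'.coeff i ∈ maximalIdeal V)
    (t : V) (ht : t ∈ maximalIdeal V) (ht0 : t ≠ 0) :
    ∃ e ∈ maximalIdeal V, e ≠ 0 ∧ e ∣ t ∧ Associated (B.eval e) (e ^ m) ∧
      Associated (B'.eval e) (e ^ m') := by
  obtain ⟨d, hd, hd0, h⟩ := aux_C hnp B m hm hlt
  obtain ⟨d', hd', hd0', h'⟩ := aux_C hnp B' m' hm' hlt'
  obtain ⟨D, hD, hD0, hDD⟩ := aux_common hnp (Finset.range 3)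
    (fun i => if i = 0 then d else if i = 1 then d' else t) (by
      intro i hi
      split_ifs <;> assumption)
  have k0 := hDD 0 (by simp)
  have k1 := hDD 1 (by simp)
  have k2 := hDD 2 (by simp)
  simp only [if_true, one_ne_zero, if_false, OfNat.ofNat_ne_zero, OfNat.ofNat_ne_one] at k0 k1 k2
  obtain ⟨e, he, hed⟩ := aux_pow hnp D hD (m + m' + 1)
  obtain ⟨u, hu, hu'⟩ := h e he (((pow_dvd_pow e (by omega)).trans hed).trans k0)
  obtain ⟨w, hw, hw'⟩ := h' e he (((pow_dvd_pow e (by omega)).trans hed).trans k1)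
  refine ⟨e, he, ?_, ((dvd_pow_self e (by omega)).trans hed).trans k2, ?_, ?_⟩
  · rintro rfl
    rw [zero_pow (by omega), zero_dvd_iff] at hed
    exact hD0 hed
  · rw [hu']; exact associated_mul_unit_left _ _ hu
  · rw [hw']; exact associated_mul_unit_left _ _ hw

lemma aux_exp {e : V} (he : e ∈ maximalIdeal V) (h0 : e ≠ 0) {m n : ℕ}
    (h : Associated (e ^ m) (e ^ n)) : m = n :=
  le_antisymm ((pow_dvd_pow_iff h0 he).1 h.dvd) ((pow_dvd_pow_iff h0 he).1 h.symm.dvd)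

lemma aux_unit_iff (b : V) : IsUnit b ↔ residue V b ≠ 0 := by
  rw [residue_ne_zero_iff_isUnit]

lemma aux_roots (hnp : ¬ (maximalIdeal V).IsPrincipal) (P Q : V[X])
    (hP : P.map (residue V) ≠ 0) (hQ : Q.map (residue V) ≠ 0)
    (h : ∀ a, Associated (P.eval a) (Q.eval a)) (t : V) (ht : t ∈ maximalIdeal V) (ht0 : t ≠ 0)
    (ξ : ResidueField V) :
    (P.map (residue V)).rootMultiplicity ξ = (Q.map (residue V)).rootMultiplicity ξ := by
  obtain ⟨a, rfl⟩ := residue_surjective ξ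
  have gen : ∀ R : V[X], R.map (residue V) ≠ 0 →
      IsUnit ((R.comp (X + C a)).coeff ((R.map (residue V)).rootMultiplicity (residue V a))) ∧
      ∀ i < (R.map (residue V)).rootMultiplicity (residue V a),
        (R.comp (X + C a)).coeff i ∈ maximalIdeal V := by
    intro R hR
    have e1 : ((R.map (residue V)).comp (X + C (residue V a))) =
        (R.comp (X + C a)).map (residue V) := by
      simp [Polynomial.map_comp]
    have hne : ((R.map (residue V)).comp (X + C (residue V a))) ≠ 0 := by
      intro h0
      apply hR
      rwa [comp_X_add_C_eq_zero_iff] at h0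
    rw [rootMultiplicity_eq_natTrailingDegree, e1]
    rw [e1] at hne
    constructor
    · rw [aux_unit_iff, ← coeff_map]
      exact trailingCoeff_nonzero_iff_nonzero.2 hne
    · intro i hi
      rw [← residue_eq_zero_iff, ← coeff_map]
      exact coeff_eq_zero_of_lt_natTrailingDegree hi
  obtain ⟨e, he, he0, -, h1, h2⟩ := aux_D hnp _ _ _ _ (gen P hP).1 (gen P hP).2
    (gen Q hQ).1 (gen Q hQ).2 t ht ht0
  refine aux_exp he he0 (h1.symm.trans (Associated.trans ?_ h2))
  simpa using h (e + a)

lemma aux_deg (hnp : ¬ (maximalIdeal V).IsPrincipal) (P Q : V[X])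
    (hP : P.map (residue V) ≠ 0) (hQ : Q.map (residue V) ≠ 0) (N : ℕ)
    (hPN : P.natDegree ≤ N) (hQN : Q.natDegree ≤ N)
    (t : V) (ht : t ∈ maximalIdeal V) (ht0 : t ≠ 0)
    (h : ∀ e ∈ maximalIdeal V, e ≠ 0 → e ∣ t →
      Associated (e * (P.reflect N).eval e) ((Q.reflect N).eval e)) :
    (P.map (residue V)).natDegree = (Q.map (residue V)).natDegree + 1 := by
  have gen : ∀ R : V[X], R.map (residue V) ≠ 0 → R.natDegree ≤ N →
      (R.map (residue V)).natDegree ≤ N ∧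
      IsUnit ((R.reflect N).coeff (N - (R.map (residue V)).natDegree)) ∧
      ∀ i < N - (R.map (residue V)).natDegree, (R.reflect N).coeff i ∈ maximalIdeal V := by
    intro R hR hRN
    have hle : (R.map (residue V)).natDegree ≤ N := natDegree_map_le.trans hRN
    refine ⟨hle, ?_, ?_⟩
    · rw [coeff_reflect, revAt_le (by omega), Nat.sub_sub_self hle, aux_unit_iff, ← coeff_map]
      exact leadingCoeff_ne_zero.2 hR
    · intro i hi
      rw [coeff_reflect, revAt_le (by omega), ← residue_eq_zero_iff, ← coeff_map]
      exact coeff_eq_zero_of_natDegree_lt (by omega)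
  obtain ⟨p1, p2, p3⟩ := gen P hP hPN
  obtain ⟨q1, q2, q3⟩ := gen Q hQ hQN
  obtain ⟨e, he, he0, het, h1, h2⟩ := aux_D hnp _ _ _ _ p2 p3 q2 q3 t ht ht0
  have := aux_exp he he0 (m := N - (P.map (residue V)).natDegree + 1)
    (n := N - (Q.map (residue V)).natDegree) (by
      rw [pow_succ']
      exact ((h1.symm.mul_left e).trans (h e he he0 het)).trans h2)
  omega

end aux

lemma aux_fin {k : Type*} [Field k]
    (hno : ¬ ∃ p q : Polynomial k,
      0 < p.natDegree ∧ 0 < q.natDegree ∧ Nat.Coprime p.natDegree q.natDegree ∧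
      (∀ ξ, ¬ p.IsRoot ξ) ∧ (∀ ξ, ¬ q.IsRoot ξ))
    (P Q : k[X]) (hP : P ≠ 0) (hQ : Q ≠ 0)
    (hr : ∀ ξ, P.rootMultiplicity ξ = Q.rootMultiplicity ξ)
    (hd : P.natDegree = Q.natDegree + 1) : False := by
  classical
  have hroots : P.roots = Q.roots := by
    ext ξ; rw [count_roots, count_roots, hr]
  obtain ⟨p, hp1, hp2, hp3⟩ := exists_prod_multiset_X_sub_C_mul P
  obtain ⟨q, hq1, hq2, hq3⟩ := exists_prod_multiset_X_sub_C_mul Q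
  have hp0 : p ≠ 0 := by rintro rfl; simp at hp1; exact hP hp1.symm
  have hq0 : q ≠ 0 := by rintro rfl; simp at hq1; exact hQ hq1.symm
  have np : ∀ ξ, ¬ p.IsRoot ξ := fun ξ h => by
    have := (mem_roots hp0).2 h
    simp [hp3] at this
  have nq : ∀ ξ, ¬ q.IsRoot ξ := fun ξ h => by
    have := (mem_roots hq0).2 h
    simp [hq3] at this
  rw [hroots] at hp2
  have hpq : p.natDegree = q.natDegree + 1 := by omega
  rcases Nat.eq_zero_or_pos q.natDegree with h | h
  · rw [h] at hpq
    obtain ⟨x, hx⟩ := exists_root_of_degree_eq_one (p := p)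
      ((degree_eq_iff_natDegree_eq_of_pos one_pos).2 hpq)
    exact np x hx
  · exact hno ⟨p, q, by omega, h, by rw [hpq]; simp, np, nq⟩

lemma aux_generic {k : Type*} [Field k]
    (hno : ¬ ∃ p q : Polynomial k,
      0 < p.natDegree ∧ 0 < q.natDegree ∧ Nat.Coprime p.natDegree q.natDegree ∧
      (∀ ξ, ¬ p.IsRoot ξ) ∧ (∀ ξ, ¬ q.IsRoot ξ))
    (f : k[X]) (hf : f ≠ 0) : ∃ ξ, f.eval ξ ≠ 0 := by
  by_contra! hcon
  have hpos : 0 < f.natDegree := by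
    rw [Nat.pos_iff_ne_zero]
    intro h
    rw [natDegree_eq_zero] at h
    obtain ⟨c, rfl⟩ := h
    have := hcon 0
    simp at this
    simp [this] at hf
  have h1 : (f + 1).natDegree = f.natDegree := by
    simpa using natDegree_add_C (p := f) (a := (1 : k))
  have h2 : (X * f + 1).natDegree = f.natDegree + 1 := by
    have := natDegree_add_C (p := X * f) (a := (1 : k))
    rw [natDegree_X_mul hf] at this
    simpa using this
  refine hno ⟨f + 1, X * f + 1, by omega, by omega, by rw [h1, h2]; simp, ?_, ?_⟩ <;>
  · intro ξ h
    simp [hcon] at h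

lemma aux_content {K : Type*} [Field K] (V : ValuationSubring K) (f : K[X]) (hf : f ≠ 0) :
    ∃ c : K, c ≠ 0 ∧ ∃ P : V[X], P.map (algebraMap V K) = C c * f ∧
      P.map (IsLocalRing.residue V) ≠ 0 := by
  obtain ⟨i, hi, hmax⟩ := Finset.exists_max_image f.support (fun i => V.valuation (f.coeff i))
    (nonempty_support_iff.2 hf)
  have hi0 : f.coeff i ≠ 0 := mem_support_iff.1 hi
  refine ⟨(f.coeff i)⁻¹, inv_ne_zero hi0, ?_⟩
  have : C (f.coeff i)⁻¹ * f ∈ lifts (algebraMap V K) := by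
    rw [lifts_iff_coeff_lifts]
    intro j
    rw [coeff_C_mul]
    have hmem : (f.coeff i)⁻¹ * f.coeff j ∈ V := by
      rw [← V.valuation_le_one_iff, map_mul, map_inv₀]
      by_cases hj : j ∈ f.support
      · have h0 : 0 < V.valuation (f.coeff i) := by
          rw [zero_lt_iff]; simpa using hi0
        rw [inv_mul_le_one₀ h0]
        exact hmax j hj
      · rw [notMem_support_iff.1 hj]; simp
    exact ⟨⟨_, hmem⟩, rfl⟩
  obtain ⟨P, hP⟩ := this
  have hP' : P.map (algebraMap V K) = C (f.coeff i)⁻¹ * f := hP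
  refine ⟨P, hP', fun h0 => ?_⟩
  have h1 : algebraMap V K (P.coeff i) = 1 := by
    rw [← coeff_map, hP', coeff_C_mul, inv_mul_cancel₀ hi0]
  have h2 : P.coeff i = 1 := by
    apply FaithfulSMul.algebraMap_injective V K; rw [h1, map_one]
  have h3 : (P.map (IsLocalRing.residue V)).coeff i = 1 := by rw [coeff_map, h2, map_one]
  rw [h0] at h3; simp at h3

lemma aux_assoc {K : Type*} [Field K] (V : ValuationSubring K) (a b : V) (u : V) (hu : IsUnit u)
    (h : (a : K) = u * b) : Associated a b := by
  have : a = u * b := Subtype.ext (by simpa using h)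
  rw [this]
  exact associated_unit_mul_left _ _ hu

lemma aux_core {K : Type*} [Field K] (V : ValuationSubring K)
    (hnp : ¬ (IsLocalRing.maximalIdeal ↥V).IsPrincipal)
    (hno : ¬ ∃ p q : Polynomial (IsLocalRing.ResidueField ↥V),
      0 < p.natDegree ∧ 0 < q.natDegree ∧ Nat.Coprime p.natDegree q.natDegree ∧
      (∀ ξ, ¬ p.IsRoot ξ) ∧ (∀ ξ, ¬ q.IsRoot ξ))
    (t : V) (ht0 : t ≠ 0) (ht : t ∈ IsLocalRing.maximalIdeal V)
    (p q : K[X]) (hp : p ≠ 0) (hq : q ≠ 0)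
    (h1 : ∀ a : V, a ∣ t → ∃ u : V, IsUnit u ∧ p.eval (a : K) = u * a * q.eval (a : K))
    (h2 : ∀ a : V, t ∣ a → ∃ u : V, IsUnit u ∧ p.eval (a : K) = u * t * q.eval (a : K)) :
    False := by
  have htK : (t : K) ≠ 0 := by simpa using ht0
  have hcomp : ∀ f : K[X], f ≠ 0 → f.comp (C (t : K) * X) ≠ 0 := by
    intro f hf h0
    exact hf ((comp_C_mul_X_eq_zero_iff (by simpa using htK)).1 h0)
  obtain ⟨c, hc, P, hPc, hP⟩ := aux_content V _ (hcomp p hp)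
  obtain ⟨d, hd, Q, hQd, hQ⟩ := aux_content V _ (hcomp q hq)
  have eP : ∀ x : K, P.eval₂ (algebraMap V K) x = c * p.eval (t * x) := by
    intro x
    rw [← eval_map, hPc]; simp
  have eQ : ∀ x : K, Q.eval₂ (algebraMap V K) x = d * q.eval (t * x) := by
    intro x
    rw [← eval_map, hQd]; simp
  have cV : ∀ (R : V[X]) (a : V), ((R.eval a : V) : K) = R.eval₂ (algebraMap V K) (a : K) := by
    intro R a
    have := eval₂_at_apply (p := R) (algebraMap V K) a
    exact this.symm
  -- the ratio of the two scaling constants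
  have hall : ∀ a : V, ∃ u : V, IsUnit u ∧
      ((P.eval a : V) : K) = u * (c * t / d) * ((Q.eval a : V) : K) := by
    intro a
    obtain ⟨u, hu, h⟩ := h2 (t * a) (dvd_mul_right _ _)
    refine ⟨u, hu, ?_⟩
    rw [cV, cV, eP, eQ]
    push_cast at h
    rw [h]
    field_simp
  obtain ⟨w, hw, hwc⟩ : ∃ w : V, IsUnit w ∧ (w : K) = c * t / d := by
    obtain ⟨ξ, hξ⟩ := aux_generic hno _ (mul_ne_zero hP hQ)
    obtain ⟨a, rfl⟩ := IsLocalRing.residue_surjective ξ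
    rw [eval_mul, mul_ne_zero_iff, eval_map_apply, eval_map_apply, ← aux_unit_iff,
      ← aux_unit_iff] at hξ
    obtain ⟨u, hu, h⟩ := hall a
    obtain ⟨⟨y, hy⟩, ⟨z, hz⟩⟩ := hξ
    obtain ⟨u, rfl⟩ := hu
    refine ⟨((u⁻¹ * y * z⁻¹ : Vˣ) : V), Units.isUnit _, ?_⟩
    have k1 : ((u : V) : K) ≠ 0 := by simp
    have k2 : ((z : V) : K) ≠ 0 := by simp
    have k3 : (((u⁻¹ : Vˣ) : V) : K) * ((u : V) : K) = 1 := by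
      norm_cast; simp
    have k4 : (((z⁻¹ : Vˣ) : V) : K) * ((z : V) : K) = 1 := by
      norm_cast; simp
    rw [← hy, ← hz] at h
    push_cast
    rw [h]
    linear_combination (c * t / d) * (((z⁻¹ : Vˣ) : V) : K) * ((z : V) : K) * k3 + (c * t / d) * k4
  have hassoc : ∀ a, Associated (P.eval a) (Q.eval a) := by
    intro a
    obtain ⟨u, hu, h⟩ := hall a
    refine aux_assoc V _ _ (u * w) (hu.mul hw) ?_
    rw [h, ← hwc]; push_cast; ring
  have hN1 : P.natDegree ≤ P.natDegree + Q.natDegree := by omega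
  have hN2 : Q.natDegree ≤ P.natDegree + Q.natDegree := by omega
  refine aux_fin hno _ _ hP hQ (aux_roots hnp P Q hP hQ hassoc t ht ht0)
    (aux_deg hnp P Q hP hQ _ hN1 hN2 t ht ht0 ?_)
  generalize P.natDegree + Q.natDegree = N at hN1 hN2
  intro e he he0 het
  obtain ⟨b, hb⟩ := het
  have heK : (e : K) ≠ 0 := by simpa using he0
  have hbK : (t : K) * (e : K)⁻¹ = b := by
    rw [hb]; push_cast; field_simp
  have refl : ∀ R : V[X], R.natDegree ≤ N → (((R.reflect N).eval e : V) : K) =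
      (e : K) ^ N * R.eval₂ (algebraMap V K) ((e : K)⁻¹) := by
    intro R hR
    let _ : Invertible ((e : K)⁻¹) := ⟨e, by field_simp, by field_simp⟩
    have h := eval₂_reflect_mul_pow (algebraMap V K) ((e : K)⁻¹) N R hR
    have h' : (⅟((e : K)⁻¹)) = (e : K) := rfl
    rw [cV, ← h, h', inv_pow, mul_comm, mul_assoc, inv_mul_cancel₀ (pow_ne_zero _ heK), mul_one]
  obtain ⟨u, hu, h⟩ := h1 b ⟨e, by rw [hb]; ring⟩
  refine aux_assoc V _ _ (u * w) (hu.mul hw) ?_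
  push_cast
  rw [refl P hN1, refl Q hN2, eP, eQ, hbK, h, hwc, hb]
  push_cast
  field_simp

lemma aux_main {K : Type*} [Field K] (V : ValuationSubring K)
    (hnp : ¬ (IsLocalRing.maximalIdeal ↥V).IsPrincipal)
    (hno : ¬ ∃ p q : Polynomial (IsLocalRing.ResidueField ↥V),
      0 < p.natDegree ∧ 0 < q.natDegree ∧ Nat.Coprime p.natDegree q.natDegree ∧
      (∀ ξ, ¬ p.IsRoot ξ) ∧ (∀ ξ, ¬ q.IsRoot ξ))
    (t : V) (ht0 : t ≠ 0) (ht : t ∈ IsLocalRing.maximalIdeal V)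
    (g c₁ c₂ r₁ r₂ : RatFunc K) (hc₁ : IntegerValued V c₁) (hc₂ : IntegerValued V c₂)
    (hr₁ : IntegerValued V r₁) (hr₂ : IntegerValued V r₂)
    (hg : g = c₁ * RatFunc.X + c₂ * RatFunc.C (t : K))
    (hX : RatFunc.X = g * r₁) (hC : RatFunc.C (t : K) = g * r₂) : False := by
  have htK : (t : K) ≠ 0 := by simpa using ht0
  have key : ∀ a : V, ∃ y x₁ x₂ s₁ s₂ : V, g.denom.eval (a : K) ≠ 0 ∧
      g.num.eval (a : K) = y * g.denom.eval (a : K) ∧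
      y = x₁ * a + x₂ * t ∧ a = y * s₁ ∧ t = y * s₂ := by
    intro a
    have dX : eval₂ (RingHom.id K) (a : K) (RatFunc.X : RatFunc K).denom ≠ 0 := by simp
    have dC : eval₂ (RingHom.id K) (a : K) (RatFunc.C (t : K)).denom ≠ 0 := by simp
    have dd : ∀ φ : RatFunc K, IntegerValued V φ →
        eval₂ (RingHom.id K) (a : K) φ.denom ≠ 0 := fun φ h => by
      exact (h a a.2).1
    have dmul : ∀ φ ψ : RatFunc K, eval₂ (RingHom.id K) (a : K) φ.denom ≠ 0 →
        eval₂ (RingHom.id K) (a : K) ψ.denom ≠ 0 →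
        eval₂ (RingHom.id K) (a : K) (φ * ψ).denom ≠ 0 := fun φ ψ h h' h0 => by
      have := eval₂_eq_zero_of_dvd_of_eval₂_eq_zero (RingHom.id K) (a : K)
        (RatFunc.denom_mul_dvd φ ψ) h0
      rw [eval₂_mul] at this
      exact mul_ne_zero h h' this
    have dadd : ∀ φ ψ : RatFunc K, eval₂ (RingHom.id K) (a : K) φ.denom ≠ 0 →
        eval₂ (RingHom.id K) (a : K) ψ.denom ≠ 0 →
        eval₂ (RingHom.id K) (a : K) (φ + ψ).denom ≠ 0 := fun φ ψ h h' h0 => by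
      have := eval₂_eq_zero_of_dvd_of_eval₂_eq_zero (RingHom.id K) (a : K)
        (RatFunc.denom_add_dvd φ ψ) h0
      rw [eval₂_mul] at this
      exact mul_ne_zero h h' this
    have vv : ∀ φ : RatFunc K, IntegerValued V φ →
        ∃ x : V, RatFunc.eval (RingHom.id K) (a : K) φ = x := fun φ h =>
      ⟨⟨_, (h a a.2).2⟩, rfl⟩
    obtain ⟨x₁, e₁⟩ := vv c₁ hc₁
    obtain ⟨x₂, e₂⟩ := vv c₂ hc₂
    obtain ⟨s₁, f₁⟩ := vv r₁ hr₁
    obtain ⟨s₂, f₂⟩ := vv r₂ hr₂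
    have dg : eval₂ (RingHom.id K) (a : K) g.denom ≠ 0 := by
      rw [hg]
      exact dadd _ _ (dmul _ _ (dd _ hc₁) dX) (dmul _ _ (dd _ hc₂) dC)
    have eg : RatFunc.eval (RingHom.id K) (a : K) g = ((x₁ * a + x₂ * t : V) : K) := by
      rw [hg, RatFunc.eval_add (RingHom.id K) (a : K) (dmul _ _ (dd _ hc₁) dX) (dmul _ _ (dd _ hc₂) dC),
        RatFunc.eval_mul (RingHom.id K) (a : K) (dd _ hc₁) dX, RatFunc.eval_mul (RingHom.id K) (a : K) (dd _ hc₂) dC, e₁, e₂]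
      simp
    have dg' : g.denom.eval (a : K) ≠ 0 := dg
    refine ⟨x₁ * a + x₂ * t, x₁, x₂, s₁, s₂, dg', ?_, rfl, ?_, ?_⟩
    · rw [← eg]
      exact (div_mul_cancel₀ _ dg').symm
    · apply Subtype.ext
      have := congrArg (RatFunc.eval (RingHom.id K) (a : K)) hX
      rw [RatFunc.eval_mul (RingHom.id K) (a : K) dg (dd _ hr₁), eg, f₁, RatFunc.eval_X] at this
      exact this
    · apply Subtype.ext
      have := congrArg (RatFunc.eval (RingHom.id K) (a : K)) hC
      rw [RatFunc.eval_mul (RingHom.id K) (a : K) dg (dd _ hr₂), eg, f₂, RatFunc.eval_C] at this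
      exact this
  have gen : ∀ a z : V, z ∣ a → z ∣ t → (z = a ∨ z = t) →
      ∃ u : V, IsUnit u ∧ g.num.eval (a : K) = u * z * g.denom.eval (a : K) := by
    intro a z hza hzt hz
    obtain ⟨y, x₁, x₂, s₁, s₂, -, hy, hy1, ha, hty⟩ := key a
    have k1 : z ∣ y := by
      rw [hy1]
      exact dvd_add (hza.mul_left _) (hzt.mul_left _)
    have k2 : y ∣ z := by
      rcases hz with h | h
      · exact ⟨s₁, h.trans ha⟩
      · exact ⟨s₂, h.trans hty⟩
    obtain ⟨u, hu⟩ := associated_of_dvd_dvd k1 k2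
    refine ⟨u, u.isUnit, ?_⟩
    rw [hy, ← hu]
    push_cast
    ring
  refine aux_core V hnp hno t ht0 ht g.num g.denom ?_ g.denom_ne_zero
    (fun a ha => gen a a dvd_rfl ha (Or.inl rfl)) (fun a ha => gen a t ha dvd_rfl (Or.inr rfl))
  rw [Ne, RatFunc.num_eq_zero_iff]
  rintro rfl
  rw [zero_mul] at hX
  exact RatFunc.X_ne_zero hX

theorem statement15 (K : Type*) [Field K] (V : ValuationSubring K)
    (hnp : ¬ (IsLocalRing.maximalIdeal ↥V).IsPrincipal)
    (hno : ¬ ∃ p q : Polynomial (IsLocalRing.ResidueField ↥V),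
      0 < p.natDegree ∧ 0 < q.natDegree ∧ Nat.Coprime p.natDegree q.natDegree ∧
      (∀ ξ, ¬ p.IsRoot ξ) ∧ (∀ ξ, ¬ q.IsRoot ξ)) :
    (∀ t : ↥V, t ≠ 0 → t ∈ IsLocalRing.maximalIdeal ↥V →
      ¬ ∃ g : RatFunc K,
        (∃ c₁ c₂ : RatFunc K, IntegerValued V c₁ ∧ IntegerValued V c₂ ∧
          g = c₁ * RatFunc.X + c₂ * RatFunc.C (t : K)) ∧
        (∃ r : RatFunc K, IntegerValued V r ∧ RatFunc.X = g * r) ∧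
        (∃ r : RatFunc K, IntegerValued V r ∧ RatFunc.C (t : K) = g * r)) ∧
    ¬ IsBezoutSet (RatFunc K) {φ | IntegerValued V φ} := by
  constructor
  · rintro t ht0 ht ⟨g, ⟨c₁, c₂, hc₁, hc₂, hg⟩, ⟨r₁, hr₁, hX⟩, ⟨r₂, hr₂, hC⟩⟩
    exact aux_main V hnp hno t ht0 ht g c₁ c₂ r₁ r₂ hc₁ hc₂ hr₁ hr₂ hg hX hC
  · intro hB
    obtain ⟨t, ht, ht0, -⟩ := aux_common hnp ∅ (fun _ => 0) (by simp)
    obtain ⟨g, -, hr, c, hc, hg⟩ := hB 2 ![RatFunc.X, RatFunc.C (t : K)] (by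
      intro i
      fin_cases i
      · intro a ha
        simpa using ha
      · intro a ha
        simp)
    obtain ⟨r₁, hr₁, hX⟩ := hr 0
    obtain ⟨r₂, hr₂, hC⟩ := hr 1
    exact aux_main V hnp hno t ht0 ht g (c 0) (c 1) r₁ r₂ (hc 0) (hc 1) hr₁ hr₂
      (by simpa [Fin.sum_univ_two] using hg) (by simpa using hX) (by simpa using hC)
end

section
/- Let V be a valuation domain with field of fractions K and maximal ideal 𝔪. Then IntR(V) is a Bézout domain if and only if 𝔪 is a principal ideal of V or there exist two nonconstant polynomials over the residue field V/𝔪 of coprime degrees neither of which has a root in V/𝔪. -/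
open Polynomial

section helpers
variable {K : Type*} [Field K] {V : ValuationSubring K}

lemma iv_mk {p q : K[X]} (h : ∀ a ∈ V, q.eval a ≠ 0 ∧ V.valuation (p.eval a) ≤ V.valuation (q.eval a)) :
    IntegerValued V (algebraMap K[X] (RatFunc K) p / algebraMap K[X] (RatFunc K) q) := by
  have hq : q ≠ 0 := by
    rintro rfl
    exact (h 0 V.zero_mem).1 (by simp)
  intro a ha
  obtain ⟨h1, h2⟩ := h a ha
  set φ := algebraMap K[X] (RatFunc K) p / algebraMap K[X] (RatFunc K) q with hφ
  have hd : φ.denom.eval a ≠ 0 := by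
    intro h0
    obtain ⟨c, hc⟩ := RatFunc.denom_div_dvd p q
    apply h1
    rw [hc, eval_mul, h0, zero_mul]
  refine ⟨hd, ?_⟩
  have e := (RatFunc.num_mul_eq_mul_denom_iff hq).2 hφ
  have e2 := congrArg (Polynomial.eval a) e
  rw [eval_mul, eval_mul] at e2
  rw [(div_eq_div_iff hd h1).2 e2, ← V.valuation_le_one_iff, map_div₀]
  apply div_le_one_of_le₀ h2 zero_le

lemma iv_exists {φ : RatFunc K} (h : IntegerValued V φ) : ∃ p q : K[X],
    φ = algebraMap K[X] (RatFunc K) p / algebraMap K[X] (RatFunc K) q ∧ q ≠ 0 ∧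
    ∀ a ∈ V, q.eval a ≠ 0 ∧ V.valuation (p.eval a) ≤ V.valuation (q.eval a) := by
  refine ⟨φ.num, φ.denom, (RatFunc.num_div_denom φ).symm, φ.denom_ne_zero, fun a ha => ?_⟩
  obtain ⟨h1, h2⟩ := h a ha
  refine ⟨h1, ?_⟩
  rw [← V.valuation_le_one_iff, map_div₀] at h2
  have : 0 < V.valuation (φ.denom.eval a) := zero_lt_iff.2 ((Valuation.ne_zero_iff _).2 h1)
  simpa using (div_le_iff₀ this).1 h2

lemma iv_mul {φ ψ : RatFunc K} (h : IntegerValued V φ) (h' : IntegerValued V ψ) :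
    IntegerValued V (φ * ψ) := by
  obtain ⟨p, q, rfl, hq, h⟩ := iv_exists h
  obtain ⟨p', q', rfl, hq', h'⟩ := iv_exists h'
  rw [div_mul_div_comm, ← map_mul, ← map_mul]
  refine iv_mk fun a ha => ?_
  rw [eval_mul, eval_mul, map_mul, map_mul]
  exact ⟨mul_ne_zero (h a ha).1 (h' a ha).1, mul_le_mul' (h a ha).2 (h' a ha).2⟩

lemma iv_add {φ ψ : RatFunc K} (h : IntegerValued V φ) (h' : IntegerValued V ψ) :
    IntegerValued V (φ + ψ) := by
  obtain ⟨p, q, rfl, hq, h⟩ := iv_exists h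
  obtain ⟨p', q', rfl, hq', h'⟩ := iv_exists h'
  rw [div_add_div _ _ (RatFunc.algebraMap_ne_zero hq) (RatFunc.algebraMap_ne_zero hq'),
    ← map_mul, ← map_mul, ← map_mul, ← map_add]
  refine iv_mk fun a ha => ?_
  simp only [eval_mul, eval_add]
  refine ⟨mul_ne_zero (h a ha).1 (h' a ha).1, ?_⟩
  refine (Valuation.map_add _ _ _).trans (max_le ?_ ?_)
  · rw [map_mul, map_mul]
    exact mul_le_mul_left (h a ha).2 _
  · rw [map_mul, map_mul]
    exact mul_le_mul_right (h' a ha).2 _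

lemma iv_poly {p : K[X]} (h : ∀ a ∈ V, V.valuation (p.eval a) ≤ 1) :
    IntegerValued V (algebraMap K[X] (RatFunc K) p) := by
  have := iv_mk (V := V) (p := p) (q := 1) (fun a ha => by simpa using h a ha)
  simpa using this

lemma iv_zero : IntegerValued V (0 : RatFunc K) := by
  simpa using iv_poly (V := V) (p := 0) (by simp)

lemma iv_one : IntegerValued V (1 : RatFunc K) := by
  simpa using iv_poly (V := V) (p := 1) (by simp)

/-- the two-generator property -/
def TwoGen (V : ValuationSubring K) : Prop :=
  ∀ a b : RatFunc K, IntegerValued V a → IntegerValued V b →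
    ∃ g r s α β : RatFunc K, IntegerValued V g ∧ IntegerValued V r ∧ IntegerValued V s ∧
      IntegerValued V α ∧ IntegerValued V β ∧ a = g * r ∧ b = g * s ∧ g = α * a + β * b

lemma bezout_of_twoGen (h : TwoGen V) : IsBezoutSet (RatFunc K) {φ | IntegerValued V φ} := by
  intro n
  induction n with
  | zero =>
    intro a _
    exact ⟨0, iv_zero, fun i => i.elim0, fun i => i.elim0, fun i => i.elim0, by simp⟩
  | succ n ih =>
    intro a ha
    obtain ⟨g, hg, hd, c, hc, hgc⟩ := ih (fun i => a i.succ) (fun i => ha i.succ)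
    obtain ⟨d, r, s, α, β, hd1, hr, hs, hα, hβ, e1, e2, e3⟩ := h (a 0) g (ha 0) hg
    refine ⟨d, hd1, ?_, Fin.cons α (fun i => β * c i), ?_, ?_⟩
    · intro i
      refine Fin.cases ⟨r, hr, e1⟩ (fun i => ?_) i
      obtain ⟨r', hr', e⟩ := hd i
      exact ⟨s * r', iv_mul hs hr', by rw [e, e2, mul_assoc]⟩
    · intro i
      refine Fin.cases hα (fun i => ?_) i
      exact iv_mul hβ (hc i)
    · rw [Fin.sum_univ_succ]
      simp only [Fin.cons_zero, Fin.cons_succ]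
      rw [e3]
      congr 1
      conv_lhs => rw [hgc]
      rw [Finset.mul_sum]
      simp [mul_assoc]

/-- data giving a generator of the ideal `(f, g)` -/
def Core (V : ValuationSubring K) : Prop :=
  ∀ f g : K[X], IsCoprime f g → ∃ S T A B : K[X], S = A * f + B * g ∧
    ∀ a ∈ V, T.eval a ≠ 0 ∧
      V.valuation (S.eval a) =
        V.valuation (T.eval a) * max (V.valuation (f.eval a)) (V.valuation (g.eval a)) ∧
      V.valuation (A.eval a) ≤ V.valuation (T.eval a) ∧
      V.valuation (B.eval a) ≤ V.valuation (T.eval a)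

lemma coprime_eval {f g : K[X]} (h : IsCoprime f g) (a : K) : f.eval a ≠ 0 ∨ g.eval a ≠ 0 := by
  obtain ⟨u, v, e⟩ := h
  by_contra hc
  push Not at hc
  have := congrArg (Polynomial.eval a) e
  simp [hc.1, hc.2] at this

lemma twoGen_of_core (h : Core V) : TwoGen V := by
  intro a b ha hb
  obtain ⟨p, q, rfl, hq, -⟩ := iv_exists ha
  obtain ⟨p', q', rfl, hq', -⟩ := iv_exists hb
  by_cases hz : p = 0 ∧ p' = 0
  · obtain ⟨rfl, rfl⟩ := hz
    exact ⟨0, 0, 0, 0, 0, iv_zero, iv_zero, iv_zero, iv_zero, iv_zero, by simp, by simp, by simp⟩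
  have hz' : ¬ (p * q' = 0 ∧ p' * q = 0) := by
    simpa [hq, hq'] using hz
  classical
  obtain ⟨f, g, hfg, e1, e2⟩ : ∃ f g : K[X], IsCoprime f g ∧
      p * q' = gcd (p * q') (p' * q) * f ∧ p' * q = gcd (p * q') (p' * q) * g := by
    obtain ⟨f, g, h1, h2, h3⟩ := extract_gcd (p * q') (p' * q)
    exact ⟨f, g, (gcd_isUnit_iff _ _).1 h3, h1, h2⟩
  set c := gcd (p * q') (p' * q) with hc
  obtain ⟨S, T, A, B, hS, hall⟩ := h f g hfg
  have hT : T ≠ 0 := by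
    rintro rfl
    exact (hall 0 V.zero_mem).1 (by simp)
  have hSv : ∀ a ∈ V, S.eval a ≠ 0 := by
    intro a ha
    obtain ⟨h1, h2, -, -⟩ := hall a ha
    rw [← Valuation.ne_zero_iff V.valuation, h2]
    refine mul_ne_zero ((Valuation.ne_zero_iff _).2 h1) ?_
    rcases coprime_eval hfg a with hf | hf
    · exact ne_of_gt (lt_max_of_lt_left (zero_lt_iff.2 ((Valuation.ne_zero_iff _).2 hf)))
    · exact ne_of_gt (lt_max_of_lt_right (zero_lt_iff.2 ((Valuation.ne_zero_iff _).2 hf)))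
  have hS0 : S ≠ 0 := by
    rintro rfl
    exact (hSv 0 V.zero_mem) (by simp)
  let m := algebraMap K[X] (RatFunc K)
  have hmq : m q ≠ 0 := RatFunc.algebraMap_ne_zero hq
  have hmq' : m q' ≠ 0 := RatFunc.algebraMap_ne_zero hq'
  have hmT : m T ≠ 0 := RatFunc.algebraMap_ne_zero hT
  have hmS : m S ≠ 0 := RatFunc.algebraMap_ne_zero hS0
  have E1 : m p * m q' = m c * m f := by rw [← map_mul, ← map_mul, ← e1]
  have E2 : m p' * m q = m c * m g := by rw [← map_mul, ← map_mul, ← e2]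
  have E3 : m S = m A * m f + m B * m g := by rw [← map_mul, ← map_mul, ← map_add, ← hS]
  have iA : IntegerValued V (m A / m T) := iv_mk fun a ha => ⟨(hall a ha).1, (hall a ha).2.2.1⟩
  have iB : IntegerValued V (m B / m T) := iv_mk fun a ha => ⟨(hall a ha).1, (hall a ha).2.2.2⟩
  have ef : IntegerValued V (m (f * T) / m S) := iv_mk fun a ha => ⟨hSv a ha, by
    rw [(hall a ha).2.1, eval_mul, map_mul, mul_comm]
    exact mul_le_mul_right (le_max_left _ _) _⟩
  have eg : IntegerValued V (m (g * T) / m S) := iv_mk fun a ha => ⟨hSv a ha, by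
    rw [(hall a ha).2.1, eval_mul, map_mul, mul_comm]
    exact mul_le_mul_right (le_max_right _ _) _⟩
  have key : (m c / (m q * m q')) * (m S / m T) =
      m A / m T * (m p / m q) + m B / m T * (m p' / m q') := by
    field_simp
    rw [E3]
    linear_combination (- m A) * E1 - m B * E2
  refine ⟨(m c / (m q * m q')) * (m S / m T), m (f * T) / m S, m (g * T) / m S,
    m A / m T, m B / m T, ?_, ef, eg, iA, iB, ?_, ?_, key⟩
  · rw [key]
    exact iv_add (iv_mul iA ha) (iv_mul iB hb)
  · change m p / m q = _
    rw [map_mul]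
    field_simp
    linear_combination E1
  · change m p' / m q' = _
    rw [map_mul]
    field_simp
    linear_combination E2

lemma core_of_principal (h : (IsLocalRing.maximalIdeal ↥V).IsPrincipal) : Core V := by
  obtain ⟨t, ht⟩ := h.principal
  have hm : ∀ x : K, V.valuation x < 1 → V.valuation x ≤ V.valuation (t : K) := by
    intro x hx
    have hxV : x ∈ V := (V.valuation_le_one_iff x).1 hx.le
    have : (⟨x, hxV⟩ : V) ∈ IsLocalRing.maximalIdeal ↥V := (V.valuation_lt_one_iff _).2 hx
    rw [ht] at this
    obtain ⟨r, hr⟩ := Ideal.mem_span_singleton'.1 this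
    exact (V.valuation_le_iff _ _).2 ⟨r, by simpa using congrArg Subtype.val hr⟩
  have ht1 : V.valuation (t : K) < 1 := by
    rw [← V.valuation_lt_one_iff, ht]
    exact Ideal.mem_span_singleton_self t
  intro f g hfg
  by_cases ht0 : (t : K) = 0
  · have hv : ∀ x : K, x ≠ 0 → V.valuation x = 1 := by
      have hv1 : ∀ x : K, x ≠ 0 → 1 ≤ V.valuation x := by
        intro x hx
        by_contra hc
        have := hm x (not_le.1 hc)
        rw [ht0, map_zero] at this
        exact hx (by simpa using this)
      intro x hx
      refine le_antisymm ?_ (hv1 x hx)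
      have := hv1 x⁻¹ (inv_ne_zero hx)
      rw [map_inv₀] at this
      exact (one_le_inv₀ (zero_lt_iff.2 ((Valuation.ne_zero_iff _).2 hx))).1 this
    have hv' : ∀ x : K, V.valuation x ≤ 1 := by
      intro x
      by_cases hx : x = 0
      · simp [hx]
      · exact (hv x hx).le
    have ⟨u, w, e⟩ := hfg
    refine ⟨1, 1, u, w, e.symm, fun a _ => ⟨by simp, ?_, by simpa using hv' _, by simpa using hv' _⟩⟩
    simp only [eval_one, map_one, one_mul]
    symm
    apply le_antisymm (max_le (hv' _) (hv' _))
    rcases coprime_eval hfg a with h | h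
    · exact le_max_of_le_left (hv _ h).ge
    · exact le_max_of_le_right (hv _ h).ge
  refine ⟨f^2 * f + C (t:K) * g^2 * g, f^2 + C (t:K) * g^2, f^2, C (t:K) * g^2, rfl, fun a _ => ?_⟩
  have hc := coprime_eval hfg a
  simp only [eval_add, eval_mul, eval_pow, eval_C]
  set x := f.eval a
  set y := g.eval a
  rcases le_or_gt (V.valuation y) (V.valuation x) with hyx | hxy
  · have hx : x ≠ 0 := by
      rintro h0
      rw [h0] at hyx hc
      simp_all
    have hx' : 0 < V.valuation x := zero_lt_iff.2 ((Valuation.ne_zero_iff _).2 hx)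
    have hx2 : 0 < V.valuation x ^ 2 := zero_lt_iff.2 (pow_ne_zero 2 hx'.ne')
    have h2 : V.valuation ((t : K) * y ^ 2) < V.valuation (x ^ 2) := by
      rw [map_mul, map_pow, map_pow]
      calc _ ≤ V.valuation (t : K) * V.valuation x ^ 2 := by gcongr
        _ < 1 * V.valuation x ^ 2 := by gcongr
        _ = _ := one_mul _
    have h3 : V.valuation ((t : K) * y ^ 2 * y) < V.valuation (x ^ 2 * x) := by
      rw [map_mul, map_mul _ _ x]
      calc _ ≤ V.valuation ((t : K) * y ^ 2) * V.valuation x := by gcongr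
        _ < _ := by gcongr
    have e2 := Valuation.map_add_eq_of_lt_left _ h2
    have e3 := Valuation.map_add_eq_of_lt_left _ h3
    rw [← Valuation.ne_zero_iff V.valuation, e2, e3, max_eq_left hyx]
    exact ⟨by simpa using hx, by simp, le_rfl, h2.le⟩
  · have hy : 0 < V.valuation y := lt_of_le_of_lt zero_le hxy
    have hxy' : V.valuation x ≤ V.valuation (t : K) * V.valuation y := by
      have := hm (x / y) (by rw [map_div₀]; exact (div_lt_one₀ hy).2 hxy)
      rw [map_div₀] at this
      exact (div_le_iff₀ hy).1 this
    have htp : 0 < V.valuation (t : K) := zero_lt_iff.2 ((Valuation.ne_zero_iff _).2 ht0)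
    have h2 : V.valuation (x ^ 2) < V.valuation ((t : K) * y ^ 2) := by
      rw [map_mul, map_pow, map_pow, pow_two, pow_two, ← mul_assoc]
      calc _ ≤ (V.valuation (t : K) * V.valuation y) * V.valuation x := by gcongr
        _ < _ := by gcongr
    have h3 : V.valuation (x ^ 2 * x) < V.valuation ((t : K) * y ^ 2 * y) := by
      rw [map_mul, map_mul _ _ y]
      calc _ ≤ V.valuation (x ^ 2) * V.valuation y := by gcongr
        _ < _ := by gcongr
    have e2 := Valuation.map_add_eq_of_lt_right _ h2
    have e3 := Valuation.map_add_eq_of_lt_right _ h3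
    rw [← Valuation.ne_zero_iff V.valuation, e2, e3, max_eq_right hxy.le]
    refine ⟨?_, by simp, h2.le, le_rfl⟩
    rw [← e2, e2]
    simp [ht0, (Valuation.ne_zero_iff _).1 hy.ne']


/-- homogenized polynomial -/
noncomputable def homP (c : ℕ → K) (n : ℕ) (f g : K[X]) : K[X] :=
  ∑ k ∈ Finset.range (n + 1), C (c k) * f ^ k * g ^ (n - k)

lemma homP_eval (c : ℕ → K) (n : ℕ) (f g : K[X]) (a : K) : (homP c n f g).eval a =
    ∑ k ∈ Finset.range (n + 1), c k * (f.eval a) ^ k * (g.eval a) ^ (n - k) := by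
  simp [homP, eval_finsetSum]

lemma homP_succ (c : ℕ → K) (n : ℕ) (f g : K[X]) : homP c (n + 1) f g =
    homP (fun k => c (k + 1)) n f g * f + (C (c 0) * g ^ n) * g := by
  unfold homP
  rw [Finset.sum_range_succ', Finset.sum_mul]
  refine congrArg₂ (fun x y => x + y) ?_ ?_
  · refine Finset.sum_congr rfl fun k _ => ?_
    rw [Nat.add_sub_add_right]
    ring
  · rw [pow_zero, Nat.sub_zero, mul_one, pow_succ, mul_assoc]

lemma homP_le (c : ℕ → K) (hc : ∀ k, V.valuation (c k) ≤ 1) (n : ℕ) (x y : K) :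
    V.valuation (∑ k ∈ Finset.range (n + 1), c k * x ^ k * y ^ (n - k)) ≤
      max (V.valuation x) (V.valuation y) ^ n := by
  refine Valuation.map_sum_le _ fun k hk => ?_
  have hk' : k ≤ n := by simpa [Nat.lt_succ_iff] using hk
  rw [map_mul, map_mul, map_pow, map_pow]
  calc _ ≤ 1 * max (V.valuation x) (V.valuation y) ^ k *
        max (V.valuation x) (V.valuation y) ^ (n - k) := by
        gcongr
        · exact hc k
        · exact le_max_left _ _
        · exact le_max_right _ _
    _ = _ := by rw [one_mul, ← pow_add, Nat.add_sub_cancel' hk']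

lemma homP_eq (P : (IsLocalRing.ResidueField ↥V)[X]) (hP : ∀ ξ, ¬ P.IsRoot ξ) (c : ℕ → V)
    (hc : ∀ k, IsLocalRing.residue V (c k) = P.coeff k) (x y : K) (hxy : x ≠ 0 ∨ y ≠ 0) :
    V.valuation (∑ k ∈ Finset.range (P.natDegree + 1), (c k : K) * x ^ k * y ^ (P.natDegree - k)) =
      max (V.valuation x) (V.valuation y) ^ P.natDegree := by
  have hP0 : P ≠ 0 := by
    rintro rfl
    exact hP 0 (by simp)
  set n := P.natDegree with hn
  rcases le_or_gt (V.valuation x) (V.valuation y) with h | h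
  · have hy : y ≠ 0 := by
      rintro rfl
      simp_all
    have hy' : 0 < V.valuation y := zero_lt_iff.2 ((Valuation.ne_zero_iff _).2 hy)
    have hz : x / y ∈ V := by
      rw [← V.valuation_le_one_iff, map_div₀]
      exact (div_le_one₀ hy').2 h
    let z : V := ⟨x / y, hz⟩
    have e : ∑ k ∈ Finset.range (n + 1), (c k : K) * x ^ k * y ^ (n - k) =
        y ^ n * ((∑ k ∈ Finset.range (n + 1), c k * z ^ k : V) : K) := by
      push_cast
      rw [Finset.mul_sum]
      refine Finset.sum_congr rfl fun k hk => ?_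
      have hk' : k ≤ n := by simpa [Nat.lt_succ_iff] using hk
      have : y ^ n = y ^ k * y ^ (n - k) := by rw [← pow_add, Nat.add_sub_cancel' hk']
      rw [this, div_pow]
      field_simp
    rw [e, map_mul, map_pow, max_eq_right h]
    have hu : IsUnit (∑ k ∈ Finset.range (n + 1), c k * z ^ k : V) := by
      rw [← IsLocalRing.residue_ne_zero_iff_isUnit]
      have := hP (IsLocalRing.residue V z)
      rw [IsRoot, eval_eq_sum_range] at this
      simpa [hc] using this
    rw [(V.valuation_eq_one_iff _).1 hu, mul_one]
  · have hx' : 0 < V.valuation x := lt_of_le_of_lt zero_le h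
    rw [max_eq_left h.le, Finset.sum_range_succ]
    have hlead : V.valuation (c n : K) = 1 := by
      rw [← V.valuation_eq_one_iff, ← IsLocalRing.residue_ne_zero_iff_isUnit, hc]
      simpa [hn] using hP0
    have e : V.valuation ((c n : K) * x ^ n * y ^ (n - n)) = V.valuation x ^ n := by
      simp [hlead]
    rw [Valuation.map_add_eq_of_lt_right, e]
    rw [e]
    refine Valuation.map_sum_lt _ (pow_ne_zero _ hx'.ne') fun k hk => ?_
    have hk' : k < n := by simpa using hk
    rw [map_mul, map_mul, map_pow, map_pow]
    have h1 : V.valuation y ^ (n - k) < V.valuation x ^ (n - k) :=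
      pow_lt_pow_left₀ h zero_le (by omega)
    have h2 : 0 < V.valuation x ^ k := zero_lt_iff.2 (pow_ne_zero _ hx'.ne')
    calc _ ≤ 1 * V.valuation x ^ k * V.valuation y ^ (n - k) := by
          gcongr
          exact V.valuation_le_one _
      _ < 1 * V.valuation x ^ k * V.valuation x ^ (n - k) := by
          rw [one_mul]
          gcongr
      _ = _ := by rw [one_mul, ← pow_add, Nat.add_sub_cancel' hk'.le]

lemma core_of_polys (P Q : (IsLocalRing.ResidueField ↥V)[X]) (hP : ∀ ξ, ¬ P.IsRoot ξ)
    (hQ : ∀ ξ, ¬ Q.IsRoot ξ) (hd : P.natDegree = Q.natDegree + 1) : Core V := by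
  choose c hc using fun k => IsLocalRing.residue_surjective (R := V) (P.coeff k)
  choose c' hc' using fun k => IsLocalRing.residue_surjective (R := V) (Q.coeff k)
  intro f g hfg
  refine ⟨homP (fun k => c k) (Q.natDegree + 1) f g, homP (fun k => c' k) Q.natDegree f g, _, _,
    homP_succ _ _ _ _, fun a ha => ?_⟩
  have hco := coprime_eval hfg a
  have hT := homP_eq Q hQ c' hc' (f.eval a) (g.eval a) hco
  have hS := homP_eq P hP c hc (f.eval a) (g.eval a) hco
  have hA := homP_le (V := V) (fun k => (c (k + 1) : K)) (fun k => V.valuation_le_one _)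
    Q.natDegree (f.eval a) (g.eval a)
  rw [hd] at hS
  rw [homP_eval, homP_eval, homP_eval, ← Valuation.ne_zero_iff V.valuation, hT, hS]
  refine ⟨pow_ne_zero _ ?_, pow_succ _ _, hA, ?_⟩
  · rcases hco with hf | hf
    · exact ne_of_gt (lt_max_of_lt_left (zero_lt_iff.2 ((Valuation.ne_zero_iff _).2 hf)))
    · exact ne_of_gt (lt_max_of_lt_right (zero_lt_iff.2 ((Valuation.ne_zero_iff _).2 hf)))
  · rw [eval_mul, eval_pow, eval_C, map_mul, map_pow]
    calc _ ≤ 1 * max (V.valuation (f.eval a)) (V.valuation (g.eval a)) ^ Q.natDegree := by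
          gcongr
          · exact V.valuation_le_one _
          · exact le_max_right _ _
      _ = _ := one_mul _

lemma core_of_coprime (p q : (IsLocalRing.ResidueField ↥V)[X])
    (hn : 0 < p.natDegree) (hm : 0 < q.natDegree) (hco : Nat.Coprime p.natDegree q.natDegree)
    (hp : ∀ ξ, ¬ p.IsRoot ξ) (hq : ∀ ξ, ¬ q.IsRoot ξ) : Core V := by
  obtain ⟨i, j, e⟩ : ∃ i j, p.natDegree * i = q.natDegree * j + 1 := by
    rcases Nat.lt_or_ge 1 q.natDegree with h | h
    · obtain ⟨i, hi⟩ := Nat.exists_mul_mod_eq_one_of_coprime hco h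
      have := Nat.div_add_mod (p.natDegree * i) q.natDegree
      exact ⟨i, p.natDegree * i / q.natDegree, by omega⟩
    · have : q.natDegree = 1 := by omega
      exact ⟨1, p.natDegree - 1, by rw [this]; omega⟩
  refine core_of_polys (p ^ i) (q ^ j) ?_ ?_ ?_
  · intro ξ h
    rw [IsRoot, eval_pow] at h
    exact hp ξ (eq_zero_of_pow_eq_zero h)
  · intro ξ h
    rw [IsRoot, eval_pow] at h
    exact hq ξ (eq_zero_of_pow_eq_zero h)
  · rw [natDegree_pow, natDegree_pow, mul_comm, e, mul_comm]

section evt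
open Filter
variable {Γ : Type*} [LinearOrderedCommGroupWithZero Γ]

instance : Nonempty (Set.Iio (1 : Γ)) := ⟨⟨0, zero_lt_one⟩⟩

variable [NoMaxOrder (Set.Iio (1 : Γ))]

lemma ev_pos : ∀ᶠ g : Set.Iio (1 : Γ) in atTop, (0 : Γ) < g := by
  filter_upwards [eventually_gt_atTop (⟨0, zero_lt_one⟩ : Set.Iio (1 : Γ))] with g hg
  exact hg

lemma ev_root (n : ℕ) : ∀ c : Γ, c < 1 → ∀ᶠ g : Set.Iio (1 : Γ) in atTop, c < (g : Γ) ^ n := by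
  induction n with
  | zero =>
    intro c hc
    exact Eventually.of_forall fun g => by rw [pow_zero]; exact hc
  | succ n ih =>
    intro c hc
    obtain ⟨⟨b, hb⟩, hcb⟩ := exists_gt (⟨c, hc⟩ : Set.Iio (1 : Γ))
    have hcb : c < b := hcb
    have hb0 : 0 < b := lt_of_le_of_lt zero_le hcb
    filter_upwards [ih (c / b) ((div_lt_one₀ hb0).2 hcb),
      eventually_gt_atTop (⟨b, hb⟩ : Set.Iio (1 : Γ))] with g h1 h2
    have h2 : b < (g : Γ) := h2
    rw [div_lt_iff₀ hb0] at h1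
    rw [pow_succ]
    exact h1.trans_le (mul_le_mul_right h2.le _)

lemma ev_lt1 {c : Γ} (hc : c < 1) (m n : ℕ) :
    ∀ᶠ g : Set.Iio (1 : Γ) in atTop, c * (g : Γ) ^ m < (g : Γ) ^ n := by
  filter_upwards [ev_root n c hc] with g hg
  refine lt_of_le_of_lt ?_ hg
  calc _ ≤ c * 1 := mul_le_mul_right (pow_le_one₀ zero_le (le_of_lt g.2)) _
    _ = c := mul_one c

lemma ev_lt2 {c : Γ} (hc : c ≤ 1) {m n : ℕ} (h : n < m) :
    ∀ᶠ g : Set.Iio (1 : Γ) in atTop, c * (g : Γ) ^ m < (g : Γ) ^ n := by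
  filter_upwards [ev_pos] with g hg
  calc _ ≤ 1 * (g : Γ) ^ m := mul_le_mul_left hc _
    _ = (g : Γ) ^ m := one_mul _
    _ < _ := pow_lt_pow_right_of_lt_one₀ hg g.2 h

lemma ev_exp_aux {A B : Γ} (hB : B ≠ 0) {i j : ℕ} (hij : i < j)
    (h : ∀ᶠ g : Set.Iio (1 : Γ) in atTop, A * (g : Γ) ^ i = B * (g : Γ) ^ j) : False := by
  have h' : ∀ᶠ g : Set.Iio (1 : Γ) in atTop, A = B * (g : Γ) ^ (j - i) := by
    filter_upwards [h, ev_pos] with g hg h0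
    have : (g : Γ) ^ i ≠ 0 := pow_ne_zero _ h0.ne'
    apply mul_right_cancel₀ this
    rw [hg, mul_assoc, ← pow_add, Nat.sub_add_cancel hij.le]
  obtain ⟨g, hg⟩ := eventually_atTop.1 (h'.and ev_pos)
  obtain ⟨g', hg'⟩ := exists_gt g
  have e1 := (hg g le_rfl).1
  have e2 := (hg g' hg'.le).1
  have e3 := mul_left_cancel₀ hB (e1.symm.trans e2)
  have : (g : Γ) ^ (j - i) < (g' : Γ) ^ (j - i) :=
    pow_lt_pow_left₀ (show (g : Γ) < g' from hg') zero_le (by omega)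
  exact this.ne e3

lemma ev_exp {A B : Γ} (hA : A ≠ 0) (hB : B ≠ 0) {i j : ℕ}
    (h : ∀ᶠ g : Set.Iio (1 : Γ) in atTop, A * (g : Γ) ^ i = B * (g : Γ) ^ j) : i = j := by
  rcases lt_trichotomy i j with hij | hij | hij
  · exact (ev_exp_aux hB hij h).elim
  · exact hij
  · exact (ev_exp_aux hA hij (h.mono fun _ e => e.symm)).elim

end evt

lemma dom_sum (s : Finset ℕ) (c : ℕ → K) (i : ℕ) (hi : i ∈ s) (hc : V.valuation (c i) = 1) (w : K)
    (hw : w ≠ 0)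
    (h : ∀ k ∈ s, k ≠ i → V.valuation (c k) * V.valuation w ^ k < V.valuation w ^ i) :
    V.valuation (∑ k ∈ s, c k * w ^ k) = V.valuation w ^ i := by
  rw [← Finset.add_sum_erase s _ hi]
  have e : V.valuation (c i * w ^ i) = V.valuation w ^ i := by simp [hc]
  rw [Valuation.map_add_eq_of_lt_left, e]
  rw [e]
  refine Valuation.map_sum_lt _ (pow_ne_zero _ ((Valuation.ne_zero_iff _).2 hw)) fun k hk => ?_
  rw [Finset.mem_erase] at hk
  rw [map_mul, map_pow]
  exact h k hk.2 hk.1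

open Filter in
lemma low_eval [NoMaxOrder (Set.Iio (1 : V.ValueGroup))] (F : V[X])
    (hF : F.map (IsLocalRing.residue V) ≠ 0) :
    ∀ᶠ g : Set.Iio (1 : V.ValueGroup) in atTop, ∀ w : K, V.valuation w = g →
      V.valuation ((F.map V.subtype).eval w) =
        V.valuation w ^ (F.map (IsLocalRing.residue V)).natTrailingDegree := by
  set i := (F.map (IsLocalRing.residue V)).natTrailingDegree with hi
  have hci : (F.map (IsLocalRing.residue V)).coeff i ≠ 0 := by
    rw [hi]
    exact trailingCoeff_nonzero_iff_nonzero.2 hF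
  rw [coeff_map, IsLocalRing.residue_ne_zero_iff_isUnit, V.valuation_eq_one_iff] at hci
  have hmem : i ∈ F.support := by
    rw [mem_support_iff]
    rintro h0
    rw [h0] at hci
    simp at hci
  have hall : ∀ᶠ g : Set.Iio (1 : V.ValueGroup) in atTop, ∀ k ∈ F.support, k ≠ i →
      V.valuation (F.coeff k : K) * (g : V.ValueGroup) ^ k < (g : V.ValueGroup) ^ i := by
    rw [eventually_all_finset]
    intro k _
    rcases lt_trichotomy k i with h | h | h
    · have : (F.map (IsLocalRing.residue V)).coeff k = 0 := coeff_eq_zero_of_lt_natTrailingDegree h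
      rw [coeff_map, IsLocalRing.residue_eq_zero_iff, V.valuation_lt_one_iff] at this
      exact (ev_lt1 this k i).mono fun _ h _ => h
    · exact Eventually.of_forall fun _ h' => (h' h).elim
    · exact (ev_lt2 (V.valuation_le_one _) h).mono fun _ h _ => h
  filter_upwards [hall, ev_pos] with g hg h0 w hw
  rw [eval_map, eval₂_eq_sum, sum_def]
  refine dom_sum F.support (fun k => (F.coeff k : K)) i hmem hci w ?_ ?_
  · rw [← Valuation.ne_zero_iff V.valuation, hw]
    exact h0.ne'
  · rw [hw]
    exact hg

open Filter in
lemma high_eval [NoMaxOrder (Set.Iio (1 : V.ValueGroup))] (F : V[X])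
    (hF : F.map (IsLocalRing.residue V) ≠ 0) :
    ∀ᶠ g : Set.Iio (1 : V.ValueGroup) in atTop, ∀ w : K, V.valuation w = g →
      V.valuation ((F.map V.subtype).eval w⁻¹) =
        V.valuation w⁻¹ ^ (F.map (IsLocalRing.residue V)).natDegree := by
  set i := (F.map (IsLocalRing.residue V)).natDegree with hi
  have hci : (F.map (IsLocalRing.residue V)).coeff i ≠ 0 := by
    rw [hi]
    exact leadingCoeff_ne_zero.2 hF
  rw [coeff_map, IsLocalRing.residue_ne_zero_iff_isUnit, V.valuation_eq_one_iff] at hci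
  have hmem : i ∈ F.support := by
    rw [mem_support_iff]
    rintro h0
    rw [h0] at hci
    simp at hci
  have hall : ∀ᶠ g : Set.Iio (1 : V.ValueGroup) in atTop, ∀ k ∈ F.support, k ≠ i →
      V.valuation (F.coeff k : K) * (g : V.ValueGroup) ^ i < (g : V.ValueGroup) ^ k := by
    rw [eventually_all_finset]
    intro k _
    rcases lt_trichotomy k i with h | h | h
    · exact (ev_lt2 (V.valuation_le_one _) h).mono fun _ h _ => h
    · exact Eventually.of_forall fun _ h' => (h' h).elim
    · have : (F.map (IsLocalRing.residue V)).coeff k = 0 := coeff_eq_zero_of_natDegree_lt h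
      rw [coeff_map, IsLocalRing.residue_eq_zero_iff, V.valuation_lt_one_iff] at this
      exact (ev_lt1 this i k).mono fun _ h _ => h
  filter_upwards [hall, ev_pos] with g hg h0 w hw
  rw [eval_map, eval₂_eq_sum, sum_def]
  have hw0 : w ≠ 0 := by
    rw [← Valuation.ne_zero_iff V.valuation, hw]
    exact h0.ne'
  refine dom_sum F.support (fun k => (F.coeff k : K)) i hmem hci w⁻¹ (inv_ne_zero hw0) ?_
  intro k hk hki
  have := hg k hk hki
  have p1 : 0 < (g : V.ValueGroup) ^ k := zero_lt_iff.2 (pow_ne_zero _ h0.ne')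
  have p2 : 0 < (g : V.ValueGroup) ^ i := zero_lt_iff.2 (pow_ne_zero _ h0.ne')
  rw [map_inv₀, hw, inv_pow, inv_pow, ← div_eq_mul_inv, div_lt_iff₀ p1, inv_mul_eq_div,
    lt_div_iff₀ p2]
  exact this

lemma exists_primitive (f : K[X]) (hf : f ≠ 0) : ∃ c : K, c ≠ 0 ∧ ∃ F : V[X],
    F.map (IsLocalRing.residue V) ≠ 0 ∧ f = C c * F.map V.subtype := by
  obtain ⟨k, hk, hmax⟩ := f.support.exists_max_image (fun k => V.valuation (f.coeff k))
    (by simpa using hf)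
  have hc : f.coeff k ≠ 0 := mem_support_iff.1 hk
  have hc' : 0 < V.valuation (f.coeff k) := zero_lt_iff.2 ((Valuation.ne_zero_iff _).2 hc)
  have hl : C (f.coeff k)⁻¹ * f ∈ lifts V.subtype := by
    rw [lifts_iff_coeff_lifts]
    intro n
    have : (C (f.coeff k)⁻¹ * f).coeff n ∈ V := by
      rw [coeff_C_mul, ← V.valuation_le_one_iff, map_mul, map_inv₀, inv_mul_eq_div]
      rw [div_le_one₀ hc']
      by_cases hn : n ∈ f.support
      · exact hmax n hn
      · rw [notMem_support_iff.1 hn]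
        simp
    exact ⟨⟨_, this⟩, rfl⟩
  obtain ⟨F, hF⟩ := (mem_lifts _).1 hl
  refine ⟨f.coeff k, hc, F, ?_, ?_⟩
  · intro h0
    have h1 := congrArg (fun p => p.coeff k) h0
    simp only [coeff_map, coeff_zero] at h1
    have h2 := congrArg (fun p => p.coeff k) hF
    simp only [coeff_map, coeff_C_mul, inv_mul_cancel₀ hc] at h2
    have h3 : F.coeff k = 1 := Subtype.ext h2
    rw [h3] at h1
    simp at h1
  · rw [hF, ← mul_assoc, ← C_mul, mul_inv_cancel₀ hc, C_1, one_mul]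

lemma noMax (hnp : ¬ (IsLocalRing.maximalIdeal ↥V).IsPrincipal) :
    NoMaxOrder (Set.Iio (1 : V.ValueGroup)) := by
  refine ⟨fun ⟨c, hc⟩ => ?_⟩
  by_contra hcon
  push Not at hcon
  obtain ⟨x, rfl⟩ := V.valuation_surjective c
  have hc : V.valuation x < 1 := hc
  have hxV : x ∈ V := (V.valuation_le_one_iff x).1 hc.le
  apply hnp
  refine ⟨⟨x, hxV⟩, le_antisymm ?_ ?_⟩
  · intro y hy
    have hy1 := (V.valuation_lt_one_iff _).1 hy
    have : V.valuation (y : K) ≤ V.valuation x := hcon ⟨_, hy1⟩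
    obtain ⟨a, ha⟩ := (V.valuation_le_iff _ _).1 this
    exact Ideal.mem_span_singleton'.2 ⟨a, Subtype.ext ha⟩
  · refine (Ideal.span_singleton_le_iff_mem _).2 ?_
    exact (V.valuation_lt_one_iff _).2 hc

lemma ratEval_mul {φ ψ : RatFunc K} (h : IntegerValued V φ) (h' : IntegerValued V ψ) {a : K}
    (ha : a ∈ V) : (φ * ψ).eval (RingHom.id K) a =
      φ.eval (RingHom.id K) a * ψ.eval (RingHom.id K) a :=
  RatFunc.eval_mul _ _ (by rw [eval₂_id]; exact (h a ha).1) (by rw [eval₂_id]; exact (h' a ha).1)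

lemma ratEval_add {φ ψ : RatFunc K} (h : IntegerValued V φ) (h' : IntegerValued V ψ) {a : K}
    (ha : a ∈ V) : (φ + ψ).eval (RingHom.id K) a =
      φ.eval (RingHom.id K) a + ψ.eval (RingHom.id K) a :=
  RatFunc.eval_add _ _ (by rw [eval₂_id]; exact (h a ha).1) (by rw [eval₂_id]; exact (h' a ha).1)

lemma ratEval_le {φ : RatFunc K} (h : IntegerValued V φ) {a : K} (ha : a ∈ V) :
    V.valuation (φ.eval (RingHom.id K) a) ≤ 1 :=
  (V.valuation_le_one_iff _).2 (h a ha).2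

lemma exists_min (hB : IsBezoutSet (RatFunc K) {φ | IntegerValued V φ}) (t : K) (ht : t ∈ V) :
    ∃ f g : K[X], ∀ a ∈ V, g.eval a ≠ 0 ∧ V.valuation (f.eval a) =
      V.valuation (g.eval a) * max (V.valuation a) (V.valuation t) := by
  have iX : IntegerValued V (RatFunc.X : RatFunc K) := by
    rw [← RatFunc.algebraMap_X]
    exact iv_poly fun a ha => by simpa [V.valuation_le_one_iff] using ha
  have iC : IntegerValued V (RatFunc.C t : RatFunc K) := by
    rw [← RatFunc.algebraMap_C]
    exact iv_poly fun a ha => by simpa [V.valuation_le_one_iff] using ht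
  obtain ⟨d, hd, hdiv, c, hc, e⟩ := hB 2 ![RatFunc.X, RatFunc.C t] (by
    intro i
    fin_cases i
    · exact iX
    · exact iC)
  obtain ⟨r, hr, er⟩ := hdiv 0
  obtain ⟨s, hs, es⟩ := hdiv 1
  rw [Fin.sum_univ_two] at e
  simp only [Matrix.cons_val_zero, Matrix.cons_val_one] at e er es
  refine ⟨d.num, d.denom, fun a ha => ⟨(hd a ha).1, ?_⟩⟩
  have hdv : V.valuation (d.eval (RingHom.id K) a) = max (V.valuation a) (V.valuation t) := by
    apply le_antisymm
    · rw [e, ratEval_add (iv_mul (hc 0) iX) (iv_mul (hc 1) iC) ha, ratEval_mul (hc 0) iX ha,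
        ratEval_mul (hc 1) iC ha, RatFunc.eval_X, RatFunc.eval_C]
      refine (Valuation.map_add _ _ _).trans (max_le_max ?_ ?_)
      · rw [map_mul]
        exact mul_le_of_le_one_left zero_le (ratEval_le (hc 0) ha)
      · rw [map_mul]
        exact mul_le_of_le_one_left zero_le (ratEval_le (hc 1) ha)
    · apply max_le
      · have := congrArg (RatFunc.eval (RingHom.id K) a) er
        rw [ratEval_mul hd hr ha, RatFunc.eval_X] at this
        have := congrArg V.valuation this
        rw [map_mul] at this
        exact this.le.trans (mul_le_of_le_one_right zero_le (ratEval_le hr ha))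
      · have := congrArg (RatFunc.eval (RingHom.id K) a) es
        rw [ratEval_mul hd hs ha, RatFunc.eval_C, RingHom.id_apply] at this
        rw [this, map_mul]
        exact mul_le_of_le_one_right zero_le (ratEval_le hs ha)
  rw [← hdv, ← map_mul]
  congr 1
  rw [RatFunc.eval, eval₂_id, eval₂_id, mul_div_cancel₀ _ (hd a ha).1]

lemma comp_ne (f : K[X]) (hf : f ≠ 0) (t : K) (ht : t ≠ 0) : f.comp (C t * X) ≠ 0 := by
  intro h
  rw [comp_eq_zero_iff] at h
  rcases h with h | ⟨-, h⟩
  · exact hf h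
  · have := congrArg (fun p => p.coeff 1) h
    simp [ht] at this

open Filter in
lemma forward (hB : IsBezoutSet (RatFunc K) {φ | IntegerValued V φ})
    (hnp : ¬ (IsLocalRing.maximalIdeal ↥V).IsPrincipal) :
    ∃ p q : Polynomial (IsLocalRing.ResidueField ↥V),
          0 < p.natDegree ∧ 0 < q.natDegree ∧ Nat.Coprime p.natDegree q.natDegree ∧
          (∀ ξ, ¬ p.IsRoot ξ) ∧ (∀ ξ, ¬ q.IsRoot ξ) := by
  have := noMax hnp
  obtain ⟨⟨γ, hγ⟩, hγ0⟩ := exists_gt (⟨0, zero_lt_one' V.ValueGroup⟩ : Set.Iio (1 : V.ValueGroup))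
  have hγ0 : 0 < γ := hγ0
  obtain ⟨t, rfl⟩ := V.valuation_surjective γ
  have ht1 : V.valuation t < 1 := hγ
  have ht0 : t ≠ 0 := (Valuation.ne_zero_iff _).1 hγ0.ne'
  have htV : t ∈ V := (V.valuation_le_one_iff t).1 ht1.le
  obtain ⟨f, g, hfg⟩ := exists_min hB t htV
  have hg0 : g ≠ 0 := by
    rintro rfl
    exact (hfg 0 V.zero_mem).1 (by simp)
  have hf0 : f ≠ 0 := by
    rintro rfl
    have h0 := hfg 0 V.zero_mem
    have := h0.2
    simp [h0.1, ht0] at this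
  obtain ⟨cf, hcf, F, hF, eF⟩ := exists_primitive (V := V) _ (comp_ne f hf0 t ht0)
  obtain ⟨cg, hcg, G, hG, eG⟩ := exists_primitive (V := V) _ (comp_ne g hg0 t ht0)
  have key : ∀ u : K, t * u ∈ V →
      V.valuation cf * V.valuation ((F.map V.subtype).eval u) =
      V.valuation cg * V.valuation ((G.map V.subtype).eval u) *
        max (V.valuation (t * u)) (V.valuation t) := by
    intro u hu
    have h := (hfg _ hu).2
    have e1 := congrArg (Polynomial.eval u) eF
    have e2 := congrArg (Polynomial.eval u) eG
    simp only [eval_comp, eval_mul, eval_C, eval_X] at e1 e2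
    rw [e1, e2, map_mul, map_mul] at h
    exact h
  have hA : V.valuation cf ≠ 0 := (Valuation.ne_zero_iff _).2 hcf
  have hBt : V.valuation cg * V.valuation t ≠ 0 :=
    mul_ne_zero ((Valuation.ne_zero_iff _).2 hcg) hγ0.ne'
  have hdeg : (G.map (IsLocalRing.residue V)).natDegree + 1 =
      (F.map (IsLocalRing.residue V)).natDegree := by
    refine ev_exp hA hBt ?_
    filter_upwards [high_eval F hF, high_eval G hG, ev_pos,
      eventually_gt_atTop (⟨V.valuation t, ht1⟩ : Set.Iio (1 : V.ValueGroup))] with γ h1 h2 h3 h4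
    obtain ⟨w, hw⟩ := V.valuation_surjective γ
    have h4 : V.valuation t < γ := h4
    have hk := key w⁻¹ (by
      rw [← V.valuation_le_one_iff, map_mul, map_inv₀, hw, ← div_eq_mul_inv, div_le_one₀ h3]
      exact h4.le)
    have hmax : V.valuation t ≤ V.valuation (t * w⁻¹) := by
      rw [map_mul, map_inv₀, hw, ← div_eq_mul_inv, le_div_iff₀ h3]
      exact mul_le_of_le_one_right zero_le (le_of_lt γ.2)
    rw [max_eq_left hmax, h1 w hw, h2 w hw, map_mul, map_inv₀, hw, inv_pow, inv_pow] at hk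
    have h3' := h3.ne'
    field_simp at hk
    rw [pow_succ, ← mul_assoc, hk, mul_assoc, mul_comm]
  have hroots : (F.map (IsLocalRing.residue V)).roots = (G.map (IsLocalRing.residue V)).roots := by
    classical
    ext ξ
    rw [count_roots, count_roots]
    obtain ⟨u₀, rfl⟩ := IsLocalRing.residue_surjective (R := V) ξ
    rw [rootMultiplicity_eq_natTrailingDegree, rootMultiplicity_eq_natTrailingDegree]
    have hcomp : ∀ H : V[X], (H.map (IsLocalRing.residue V)).comp
        (X + C (IsLocalRing.residue V u₀)) = (H.comp (X + C u₀)).map (IsLocalRing.residue V) := by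
      intro H
      simp [Polynomial.map_comp]
    have hcne : ∀ H : V[X], H.map (IsLocalRing.residue V) ≠ 0 →
        (H.comp (X + C u₀)).map (IsLocalRing.residue V) ≠ 0 := by
      intro H hH h0
      rw [← hcomp, comp_eq_zero_iff] at h0
      rcases h0 with h | ⟨-, h⟩
      · exact hH h
      · have := congrArg (fun p => p.coeff 1) h
        simp [coeff_C] at this
    have hev : ∀ (H : V[X]) (w : K), ((H.comp (X + C u₀)).map V.subtype).eval w =
        (H.map V.subtype).eval (w + u₀) := by
      intro H w
      simp [Polynomial.map_comp]
    rw [hcomp, hcomp]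
    refine ev_exp hA hBt ?_
    filter_upwards [low_eval _ (hcne F hF), low_eval _ (hcne G hG)] with γ h1 h2
    obtain ⟨w, hw⟩ := V.valuation_surjective γ
    have hwV : w ∈ V := by
      rw [← V.valuation_le_one_iff, hw]
      exact le_of_lt γ.2
    have huV : w + u₀ ∈ V := V.add_mem _ _ hwV u₀.2
    have hk := key (w + u₀) (V.mul_mem _ _ htV huV)
    have hmax : V.valuation (t * (w + u₀)) ≤ V.valuation t := by
      rw [map_mul]
      exact mul_le_of_le_one_right zero_le ((V.valuation_le_one_iff _).2 huV)
    have h1 := h1 w hw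
    have h2 := h2 w hw
    rw [hev, hw] at h1 h2
    rw [max_eq_right hmax, h1, h2] at hk
    rw [hk, mul_right_comm]
  obtain ⟨p, hp, dp, rp⟩ := exists_prod_multiset_X_sub_C_mul (F.map (IsLocalRing.residue V))
  obtain ⟨q, hq, dq, rq⟩ := exists_prod_multiset_X_sub_C_mul (G.map (IsLocalRing.residue V))
  have hp0 : p ≠ 0 := by
    rintro rfl
    exact hF (by rw [← hp, mul_zero])
  have hq0 : q ≠ 0 := by
    rintro rfl
    exact hG (by rw [← hq, mul_zero])
  have nrp : ∀ ξ, ¬ p.IsRoot ξ := fun ξ h => by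
    have := (mem_roots hp0).2 h
    simp [rp] at this
  have nrq : ∀ ξ, ¬ q.IsRoot ξ := fun ξ h => by
    have := (mem_roots hq0).2 h
    simp [rq] at this
  rw [hroots] at dp
  have hd : p.natDegree = q.natDegree + 1 := by omega
  refine ⟨p, q, by omega, ?_, ?_, nrp, nrq⟩
  · by_contra h0
    have hd1 : p.degree = 1 := (degree_eq_iff_natDegree_eq_of_pos one_pos).2 (by omega)
    obtain ⟨ξ, hξ⟩ := exists_root_of_degree_eq_one hd1
    exact nrp ξ hξ
  · rw [hd]
    simp

end helpers

/-- Let `V` be a valuation domain with fraction field `K` and maximal ideal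
`𝔪`.  Then `IntR(V)` is a Bézout domain if and only if `𝔪` is principal or there exist two
nonconstant polynomials over the residue field `V/𝔪` of coprime degrees neither of which has
a root in `V/𝔪`. -/
theorem statement16 (K : Type*) [Field K] (V : ValuationSubring K) :
    IsBezoutSet (RatFunc K) {φ | IntegerValued V φ} ↔
      ((IsLocalRing.maximalIdeal ↥V).IsPrincipal ∨
        ∃ p q : Polynomial (IsLocalRing.ResidueField ↥V),
          0 < p.natDegree ∧ 0 < q.natDegree ∧ Nat.Coprime p.natDegree q.natDegree ∧
          (∀ ξ, ¬ p.IsRoot ξ) ∧ (∀ ξ, ¬ q.IsRoot ξ)) := by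
  constructor
  · intro hB
    by_cases h : (IsLocalRing.maximalIdeal ↥V).IsPrincipal
    · exact Or.inl h
    · exact Or.inr (forward hB h)
  · rintro (h | ⟨p, q, h1, h2, h3, h4, h5⟩)
    · exact bezout_of_twoGen (twoGen_of_core (core_of_principal h))
    · exact bezout_of_twoGen (twoGen_of_core (core_of_coprime p q h1 h2 h3 h4 h5))
end
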